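/- arXiv:2006.10420 — 2 statements merged into one kernel-verified Lean document; each statement's English description precedes it below -/
import Mathlib

section
/- Eventually pseudo-Anosov behavior without moment conditions (Theorem B, free-group form). Let F₂ be the free group on two generators a and b. Let ν be a probability measure on F₂ such that the subgroup generated by supp ν is finitely generated and non-abelian. Let ω_n = Z₁Z₂⋯Z_n be the random walk driven by ν. Then almost surely there exists N ∈ ℕ such that for all n > N, the element ω_n is NOT conjugate in F₂ to any power of a, any power of b, or any power of ab. (By the classification of elements in Thurston's construction with ⟨T_A,T_B⟩ ≅ F₂, this says the random walk is eventually pseudo-Anosov.) -/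
open MeasureTheory ProbabilityTheory Filter

noncomputable section

/-- The free group on two generators. -/
abbrev F₂ := FreeGroup (Fin 2)

/-- The first free generator. -/
def genA : F₂ := FreeGroup.of 0

/-- The second free generator. -/
def genB : F₂ := FreeGroup.of 1

instance : MeasurableSpace F₂ := ⊤
instance : MeasurableSingletonClass F₂ := ⟨fun _ => trivial⟩

/-- The position of the random walk at time `n`: the ordered product `Z₁ Z₂ ⋯ Z_n`. -/
def walk {Ω : Type} (Z : ℕ → Ω → F₂) (n : ℕ) (x : Ω) : F₂ :=
  ((List.range n).map fun i => Z (i + 1) x).prod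

open scoped ENNReal

namespace PingPong

section LabelSum

variable {ι G : Type*} [Fintype ι]

/-- The sum of `F` over all ways of labelling the entries of a list by elements of `ι`. -/
def labelSum : List G → (List (ι × G) → ℝ≥0∞) → ℝ≥0∞
  | [], F => F []
  | h :: L, F => ∑ i, labelSum L fun w => F ((i, h) :: w)

lemma labelSum_mono (L : List G) {F F' : List (ι × G) → ℝ≥0∞} (h : ∀ w, F w ≤ F' w) :
    labelSum L F ≤ labelSum L F' := by
  induction L generalizing F F' with
  | nil => exact h _
  | cons a L ih => exact Finset.sum_le_sum fun i _ => ih fun w => h _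

lemma labelSum_add (L : List G) (F F' : List (ι × G) → ℝ≥0∞) :
    labelSum L (fun w => F w + F' w) = labelSum L F + labelSum L F' := by
  induction L generalizing F F' with
  | nil => rfl
  | cons a L ih => simp only [labelSum, ih, Finset.sum_add_distrib]

lemma labelSum_sum {κ : Type*} (s : Finset κ) (L : List G) (F : κ → List (ι × G) → ℝ≥0∞) :
    labelSum L (fun w => ∑ k ∈ s, F k w) = ∑ k ∈ s, labelSum L (F k) := by
  induction L generalizing F with
  | nil => rfl
  | cons a L ih => simp only [labelSum, ih]; exact Finset.sum_comm

lemma labelSum_const_mul (c : ℝ≥0∞) (L : List G) (F : List (ι × G) → ℝ≥0∞) :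
    labelSum L (fun w => c * F w) = c * labelSum L F := by
  induction L generalizing F with
  | nil => rfl
  | cons a L ih => simp only [labelSum, ih, Finset.mul_sum]

lemma labelSum_append (L L' : List G) (F : List (ι × G) → ℝ≥0∞) :
    labelSum (L ++ L') F = labelSum L fun w => labelSum L' fun v => F (w ++ v) := by
  induction L generalizing F with
  | nil => rfl
  | cons a L ih => simp [labelSum, ih]

lemma labelSum_lintegral {X : Type*} [MeasurableSpace X] [DiscreteMeasurableSpace X]
    (μ : MeasureTheory.Measure X) (L : List G) (F : List (ι × G) → X → ℝ≥0∞) :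
    labelSum L (fun w => ∫⁻ x, F w x ∂μ) = ∫⁻ x, labelSum L (fun w => F w x) ∂μ := by
  induction L generalizing F with
  | nil => rfl
  | cons a L ih =>
    simp only [labelSum, ih]
    rw [MeasureTheory.lintegral_finsetSum _ fun i _ => Measurable.of_discrete]

end LabelSum

section Counting

variable {ι G : Type*} [Fintype ι] [Group G]

/-- The product `hₙ sₙ ⋯ h₁ s₁` attached to a labelled list `[(i₁, h₁), …, (iₙ, hₙ)]`. -/
def prodLeft (s : ι → G) : List (ι × G) → G
  | [] => 1
  | p :: w => prodLeft s w * (p.2 * s p.1)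

/-- The product `s₁ h₁ ⋯ sₙ hₙ` attached to a labelled list `[(i₁, h₁), …, (iₙ, hₙ)]`. -/
def prodRight (s : ι → G) : List (ι × G) → G
  | [] => 1
  | p :: w => s p.1 * p.2 * prodRight s w

/-- Consecutive entries of the labelled list do not satisfy `bad`. -/
def GoodChain (bad : G → ι → ι → Prop) (w : List (ι × G)) : Prop :=
  w.IsChain fun p q => ¬ bad p.2 p.1 q.1

omit [Fintype ι] in
lemma prodRight_append (s : ι → G) (w v : List (ι × G)) :
    prodRight s (w ++ v) = prodRight s w * prodRight s v := by
  induction w with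
  | nil => simp [prodRight]
  | cons p w ih => simp [prodRight, ih, mul_assoc]

open Classical in
/-- The number of labellings of `L` and `R` for which `R` is a good chain and the total product
lies in `P`. -/
def zipCount (s : ι → G) (bad : G → ι → ι → Prop) (P : Set G)
    (L : List G) (g : G) (R : List G) : ℝ≥0∞ :=
  labelSum L fun w => labelSum R fun v =>
    if GoodChain bad v ∧ prodLeft s w * g * prodRight s v ∈ P then 1 else 0

variable {s : ι → G} {bad : G → ι → ι → Prop} {P : Set G} {β : ℝ≥0∞}

omit [Group G] in
open Classical in
lemma sum_bad_le (hbad : ∀ g, (Finset.univ.filter fun p : ι × ι => bad g p.1 p.2).card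
      ≤ 3 * Fintype.card ι) (hβ : 3 * (Fintype.card ι : ℝ≥0∞) ≤ β ^ 2)
    (g : G) (X : ι → ι → ℝ≥0∞) (c : ℝ≥0∞) (hX : ∀ i j, X i j ≤ c) :
    ∑ i, ∑ j, (if bad g i j then X i j else 0) ≤ β ^ 2 * c := by
  rw [← Fintype.sum_prod_type' (f := fun i j => if bad g i j then X i j else 0),
    ← Finset.sum_filter]
  refine (Finset.sum_le_card_nsmul _ _ c fun p _ => hX _ _).trans ?_
  rw [nsmul_eq_mul]
  gcongr
  refine le_trans ?_ hβ
  exact_mod_cast hbad g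

lemma zipCount_nil_le (hconj : ∀ x g, x ∈ P → g * x * g⁻¹ ∈ P)
    (hbad : ∀ g, {p : ι × ι | bad g p.1 p.2}.ncard ≤ 3 * Fintype.card ι)
    (hβ : 3 * (Fintype.card ι : ℝ≥0∞) ≤ β ^ 2) (hβ1 : 1 ≤ β)
    (hclosed : ∀ p v, GoodChain bad (p :: v ++ [p]) → prodRight s (p :: v) ∉ P)
    (R : List G) (g : G) :
    zipCount s bad P [] g R ≤ (Fintype.card ι + 1) * β ^ R.length := by
  classical
  have hbad' : ∀ g, (Finset.univ.filter fun p : ι × ι => bad g p.1 p.2).card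
      ≤ 3 * Fintype.card ι := fun g => by
    rw [← Set.ncard_coe_finset]; simpa using hbad g
  induction R using List.bidirectionalRec generalizing g with
  | nil =>
    simp only [zipCount, labelSum]
    split_ifs <;> simp
  | singleton h =>
    simp only [zipCount, labelSum, List.length_singleton, pow_one]
    calc _ ≤ ∑ i : ι, (1 : ℝ≥0∞) := Finset.sum_le_sum fun i _ => by split_ifs <;> simp
      _ = (Fintype.card ι : ℝ≥0∞) * 1 := by simp
      _ ≤ _ := by gcongr; simp
  | cons_append h R h' ih =>
    have key : zipCount s bad P [] g (h :: (R ++ [h'])) ≤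
        ∑ i', ∑ i, if bad (h' * g) i' i then
          zipCount s bad P [] (s i' * (h' * g) * (s i * h)) R else 0 := by
      simp only [zipCount, labelSum, labelSum_append]
      rw [Finset.sum_comm]
      refine Finset.sum_le_sum fun i _ => ?_
      rw [labelSum_sum]
      refine Finset.sum_le_sum fun i' _ => ?_
      by_cases hb : bad (h' * g) i' i
      · rw [if_pos hb]
        refine labelSum_mono _ fun v => ?_
        by_cases hc : GoodChain bad ((i, h) :: (v ++ [(i', h')])) ∧
            prodLeft s [] * g * prodRight s ((i, h) :: (v ++ [(i', h')])) ∈ P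
        · rw [if_pos hc, if_pos]
          refine ⟨?_, ?_⟩
          · exact (List.isChain_append.1 (List.isChain_cons.1 hc.1).2).1
          · have := hconj _ (s i' * h') hc.2
            simp only [prodLeft, prodRight, prodRight_append] at this ⊢
            convert this using 1
            group
        · rw [if_neg hc]; exact zero_le
      · rw [if_neg hb]
        refine (labelSum_mono _ (F' := fun _ => 0 * 0) fun v => ?_).trans
          (by rw [labelSum_const_mul]; simp)
        rw [if_neg, mul_zero]
        rintro ⟨h1, h2⟩
        refine hclosed (i, h) (v ++ [(i', h' * g)]) ?_ ?_
        · have h3 : GoodChain bad ([((i, h) : ι × G)] ++ v ++ [(i', h')]) := by simpa using h1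
          have : GoodChain bad ([((i, h) : ι × G)] ++ v ++ [(i', h' * g)]) := by
            unfold GoodChain at h3 ⊢
            rw [List.isChain_append] at h3 ⊢
            exact ⟨h3.1, by simp, by simpa using h3.2.2⟩
          have e : (i, h) :: (v ++ [(i', h' * g)]) ++ [(i, h)] =
            ([((i, h) : ι × G)] ++ v ++ [(i', h' * g)]) ++ [(i, h)] := by simp
          rw [e]
          unfold GoodChain at this ⊢
          rw [List.isChain_append]
          refine ⟨this, by simp, ?_⟩
          intro x hx y hy
          simp only [List.getLast?_concat, Option.mem_some_iff] at hx
          simp at hy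
          subst hx; subst hy
          exact hb
        · have := hconj _ (g⁻¹) h2
          simp only [prodLeft, prodRight, prodRight_append] at this ⊢
          convert this using 1
          group
    refine key.trans ((sum_bad_le hbad' hβ _ _ _ fun i j => ih _).trans (le_of_eq ?_))
    simp only [List.length_cons, List.length_append, List.length_nil]
    ring

lemma zipCount_le (hconj : ∀ x g, x ∈ P → g * x * g⁻¹ ∈ P)
    (hbad : ∀ g, {p : ι × ι | bad g p.1 p.2}.ncard ≤ 3 * Fintype.card ι)
    (hβ : 3 * (Fintype.card ι : ℝ≥0∞) ≤ β ^ 2) (hβ1 : 1 ≤ β)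
    (hclosed : ∀ p v, GoodChain bad (p :: v ++ [p]) → prodRight s (p :: v) ∉ P)
    (L : List G) (g : G) (R : List G) :
    zipCount s bad P L g R ≤ (Fintype.card ι + 1) * β ^ R.length * (2 * β) ^ L.length := by
  classical
  have hbad' : ∀ g, (Finset.univ.filter fun p : ι × ι => bad g p.1 p.2).card
      ≤ 3 * Fintype.card ι := fun g => by
    rw [← Set.ncard_coe_finset]; simpa using hbad g
  induction L generalizing g R with
  | nil => simpa using zipCount_nil_le hconj hbad hβ hβ1 hclosed R g
  | cons h L ih =>
    cases R with
    | nil =>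
      have key : zipCount s bad P (h :: L) g [] ≤ zipCount s bad P L h [g] := by
        simp only [zipCount, labelSum]
        rw [← labelSum_sum]
        refine labelSum_mono _ fun w => Finset.sum_le_sum fun i _ => le_of_eq ?_
        simp [GoodChain, prodLeft, prodRight, mul_assoc]
      refine key.trans ((ih _ _).trans ?_)
      simp only [List.length_cons, List.length_nil, pow_succ, pow_zero]
      calc (Fintype.card ι + 1) * (1 * β) * (2 * β) ^ L.length
          ≤ (Fintype.card ι + 1) * (2 * β) * (2 * β) ^ L.length := by
            gcongr; exact one_le_two
        _ = _ := by ring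
    | cons h' R =>
      have key : zipCount s bad P (h :: L) g (h' :: R) ≤ zipCount s bad P L h (g :: h' :: R) +
          ∑ i, ∑ j, if bad g i j then
            zipCount s bad P L (h * (s i * g * s j * h')) R else 0 := by
        have e1 : zipCount s bad P L h (g :: h' :: R) = ∑ i, ∑ j, labelSum L fun w =>
            labelSum R fun v => if GoodChain bad ((i, g) :: (j, h') :: v) ∧
              prodLeft s w * h * prodRight s ((i, g) :: (j, h') :: v) ∈ P then 1 else 0 := by
          simp only [zipCount, labelSum, labelSum_sum]
        rw [e1, ← Finset.sum_add_distrib]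
        simp_rw [← Finset.sum_add_distrib]
        simp only [zipCount, labelSum, labelSum_sum]
        refine Finset.sum_le_sum fun i _ => Finset.sum_le_sum fun j _ => ?_
        by_cases hb : bad g i j
        · rw [if_pos hb]
          refine le_trans ?_ le_add_self
          refine labelSum_mono _ fun w => labelSum_mono _ fun v => ?_
          split_ifs with h1 h2 h2
          · exact le_rfl
          · refine absurd ⟨(List.isChain_cons.1 h1.1).2, ?_⟩ h2
            have := h1.2
            simp only [prodLeft, prodRight] at this ⊢
            convert this using 1
            group
          · simp
          · exact le_rfl
        · rw [if_neg hb, add_zero]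
          refine labelSum_mono _ fun w => labelSum_mono _ fun v => ?_
          split_ifs with h1 h2 h2
          · exact le_rfl
          · refine absurd ⟨List.isChain_cons_cons.2 ⟨hb, h1.1⟩, ?_⟩ h2
            have := h1.2
            simp only [prodLeft, prodRight] at this ⊢
            convert this using 1
            group
          · simp
          · exact le_rfl
      refine key.trans ((add_le_add (ih _ _)
        (sum_bad_le hbad' hβ _ _ _ fun i j => ih _ _)).trans (le_of_eq ?_))
      simp only [List.length_cons]
      ring

end Counting

open scoped Pointwise

section Averages

variable {G : Type*} [Group G] [Countable G] [MeasurableSpace G] [DiscreteMeasurableSpace G]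

/-- The Markov operator of the right random walk with step distribution `μ`. -/
def avg (μ : Measure G) (F : G → ℝ≥0∞) (x : G) : ℝ≥0∞ := ∫⁻ z, F (x * z) ∂μ

/-- The law of the `n`-th step of the right random walk with step distribution `ν`. -/
def convPow (ν : Measure G) : ℕ → Measure G
  | 0 => Measure.dirac 1
  | n + 1 => convPow ν n ∗ₘ ν

instance (ν : Measure G) [IsProbabilityMeasure ν] (n : ℕ) :
    IsProbabilityMeasure (convPow ν n) := by
  induction n with
  | zero => unfold convPow; infer_instance
  | succ n ih => unfold convPow; infer_instance

lemma avg_iterate (ν : Measure G) [IsProbabilityMeasure ν] (n : ℕ) :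
    (avg ν)^[n] = avg (convPow ν n) := by
  induction n with
  | zero => funext F x; simp [avg, convPow]
  | succ n ih =>
    funext F x
    rw [Function.iterate_succ_apply, ih]
    simp only [avg, convPow]
    rw [Measure.lintegral_mconv Measurable.of_discrete]
    simp [mul_assoc]

lemma convPow_singleton_ne_zero (ν : Measure G) [IsProbabilityMeasure ν] (n : ℕ) {g : G}
    (hg : g ∈ {g : G | ν {g} ≠ 0} ^ n) : convPow ν n {g} ≠ 0 := by
  induction n generalizing g with
  | zero =>
    rw [pow_zero, Set.mem_one] at hg
    simp [convPow, hg]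
  | succ n ih =>
    rw [pow_succ] at hg
    obtain ⟨x, hx, y, hy, rfl⟩ := Set.mem_mul.1 hg
    have hx := ih hx
    have hy : ν {y} ≠ 0 := hy
    refine ne_of_gt (lt_of_lt_of_le (pos_iff_ne_zero.2 (mul_ne_zero hx hy)) ?_)
    rw [convPow, Measure.mconv, Measure.map_apply Measurable.of_discrete .of_discrete,
      ← Measure.prod_prod]
    refine measure_mono ?_
    rintro ⟨p, q⟩ ⟨rfl, rfl⟩
    rfl

omit [Group G] in
/-- A measure dominating `ε` times the counting measure of a finite set splits off that part. -/
lemma exists_splitting {ι : Type*} [Fintype ι] (μ : Measure G) [IsProbabilityMeasure μ]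
    {s : ι → G} (hs : Function.Injective s) (hμ : ∀ i, μ {s i} ≠ 0) :
    ∃ (ε : ℝ≥0∞) (μ' : Measure G), ε ≠ 0 ∧
      μ = μ' + ε • ∑ i, Measure.dirac (s i) := by
  classical
  obtain ⟨ε, hε0, hε1, hε⟩ : ∃ ε : ℝ≥0∞, ε ≠ 0 ∧ ε ≠ ∞ ∧ ∀ i, ε ≤ μ {s i} := by
    cases isEmpty_or_nonempty ι
    · exact ⟨1, by simp, by simp, fun i => isEmptyElim i⟩
    · obtain ⟨i, hi⟩ := Finite.exists_min fun i => μ {s i}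
      exact ⟨μ {s i}, hμ i, measure_ne_top _ _, hi⟩
  have : IsFiniteMeasure (ε • ∑ i, Measure.dirac (s i)) := by
    refine ⟨?_⟩
    simp only [Measure.smul_apply, Measure.coe_finsetSum, Finset.sum_apply, smul_eq_mul,
      measure_univ, Finset.sum_const, nsmul_eq_mul, mul_one]
    exact ENNReal.mul_lt_top hε1.lt_top (by simp)
  refine ⟨ε, μ - ε • ∑ i, Measure.dirac (s i), hε0, (Measure.sub_add_cancel_of_le ?_).symm⟩
  rw [Measure.le_iff]
  intro A _
  calc (ε • ∑ i, Measure.dirac (s i)) A = ∑ i, if s i ∈ A then ε else 0 := by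
        simp only [Measure.smul_apply, Measure.coe_finsetSum, Finset.sum_apply, smul_eq_mul,
          Finset.mul_sum]
        refine Finset.sum_congr rfl fun i _ => ?_
        by_cases h : s i ∈ A <;> simp [h]
    _ ≤ ∑ i, if s i ∈ A then μ {s i} else 0 :=
        Finset.sum_le_sum fun i _ => by split_ifs <;> simp [hε]
    _ = ∑ i ∈ Finset.univ.filter (fun i => s i ∈ A), μ {s i} := by rw [Finset.sum_filter]
    _ = ∑ g ∈ (Finset.univ.filter (fun i => s i ∈ A)).image s, μ {g} :=
        (Finset.sum_image (f := fun g => μ {g}) fun i _ j _ h => hs h).symm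
    _ = μ ((Finset.univ.filter (fun i => s i ∈ A)).image s) := by simp
    _ ≤ μ A := measure_mono (by intro g; simp; rintro i hi rfl; exact hi)

/-- Uniform exponential decay from a counting bound. -/
lemma exists_decay {ι : Type*} [Fintype ι] (μ : Measure G) [IsProbabilityMeasure μ]
    {s : ι → G} (hs : Function.Injective s) (hμ : ∀ i, μ {s i} ≠ 0)
    (f : G → ℝ≥0∞) {C γ : ℝ≥0∞} (hγ : γ < Fintype.card ι)
    (hf : ∀ L g, labelSum L (fun w : List (ι × G) => f (prodLeft s w * g)) ≤ C * γ ^ L.length) :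
    ∃ θ < 1, ∀ q g, (avg μ)^[q] f g ≤ C * θ ^ q := by
  obtain ⟨ε, μ', hε, hμ'⟩ := exists_splitting μ hs hμ
  have htot : μ' Set.univ + ε * Fintype.card ι = 1 := by
    have := congrArg (fun m : Measure G => m Set.univ) hμ'
    simpa [eq_comm] using this
  have hN : (Fintype.card ι : ℝ≥0∞) ≠ 0 := (pos_of_gt hγ).ne'
  have hεt : ε ≠ ∞ := by
    rintro rfl
    rw [ENNReal.top_mul hN] at htot
    simp at htot
  refine ⟨μ' Set.univ + ε * γ, ?_, ?_⟩
  · rw [← htot]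
    refine ENNReal.add_lt_add_left ?_ ((ENNReal.mul_lt_mul_iff_right hε hεt).2 hγ)
    exact ne_top_of_le_ne_top ENNReal.one_ne_top (htot ▸ le_self_add)
  · have key : ∀ q (L : List G) g, labelSum L (fun w : List (ι × G) =>
        (avg μ)^[q] f (prodLeft s w * g)) ≤ C * γ ^ L.length * (μ' Set.univ + ε * γ) ^ q := by
      intro q
      induction q with
      | zero => simpa using hf
      | succ q ih =>
        intro L g
        simp only [Function.iterate_succ_apply']
        set F := (avg μ)^[q] f
        have e : ∀ x, avg μ F x = ∫⁻ z, F (x * z) ∂μ' + ε * ∑ i, F (x * s i) := by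
          intro x
          conv_lhs => rw [avg, hμ']
          rw [lintegral_add_measure, lintegral_smul_measure, lintegral_finsetSum_measure]
          simp
        simp only [e, labelSum_add, labelSum_lintegral, labelSum_const_mul]
        calc _ ≤ (∫⁻ _, C * γ ^ L.length * (μ' Set.univ + ε * γ) ^ q ∂μ') +
              ε * (C * γ ^ (L.length + 1) * (μ' Set.univ + ε * γ) ^ q) := by
              gcongr with z
              · simpa only [mul_assoc] using ih L (g * z)
              · have := ih (g :: L) 1
                simp only [labelSum, prodLeft, List.length_cons, mul_one] at this
                simpa only [labelSum_sum, mul_assoc] using this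
          _ = _ := by rw [lintegral_const]; ring
    intro q g
    simpa [labelSum, prodLeft] using key q [] g

/-- Decay along a subsequence of times gives summability along all times. -/
lemma tsum_iterate_ne_top (ν : Measure G) [IsProbabilityMeasure ν] {k : ℕ} (hk : k ≠ 0)
    (f : G → ℝ≥0∞) {C θ : ℝ≥0∞} (hC : C ≠ ∞) (hθ : θ < 1)
    (h : ∀ q g, (avg (convPow ν k))^[q] f g ≤ C * θ ^ q) :
    ∑' n, (avg ν)^[n] f 1 ≠ ∞ := by
  have : NeZero k := ⟨hk⟩
  have hb : ∀ n, (avg ν)^[n] f 1 ≤ C * θ ^ (n / k) := by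
    intro n
    conv_lhs => rw [← Nat.mod_add_div n k, Function.iterate_add_apply, Function.iterate_mul,
      avg_iterate ν k, avg_iterate ν (n % k)]
    calc _ ≤ ∫⁻ _, C * θ ^ (n / k) ∂(convPow ν (n % k)) := lintegral_mono fun z => h _ _
      _ = _ := by simp
  refine ne_top_of_le_ne_top ?_ (ENNReal.tsum_le_tsum hb)
  rw [ENNReal.tsum_mul_left]
  refine ENNReal.mul_ne_top hC ?_
  have : ∑' n, θ ^ (n / k) = ∑' p : ℕ × Fin k, θ ^ p.1 :=
    (Nat.divModEquiv k).tsum_eq (fun p : ℕ × Fin k => θ ^ p.1)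
  rw [this, ENNReal.tsum_prod (f := fun q (_ : Fin k) => θ ^ q)]
  simp only [tsum_fintype, Finset.sum_const, Finset.card_univ, Fintype.card_fin, nsmul_eq_mul]
  rw [ENNReal.tsum_mul_left, ENNReal.tsum_geometric]
  exact ENNReal.mul_ne_top (by simp) (ENNReal.inv_ne_top.2 (tsub_pos_of_lt hθ).ne')

end Averages

lemma aemeasurable_walk {Ω : Type} [MeasureSpace Ω] {Z : ℕ → Ω → F₂}
    (hZ : ∀ i, AEMeasurable (Z i) (ℙ : Measure Ω)) (n : ℕ) : AEMeasurable (walk Z n) ℙ := by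
  induction n with
  | zero => exact aemeasurable_const
  | succ n ih =>
    have : walk Z (n + 1) = walk Z n * Z (n + 1) := by
      funext x; simp [walk, List.range_succ]
    rw [this]
    exact ih.mul (hZ _)

lemma map_walk (ν : Measure F₂) [IsProbabilityMeasure ν] {Ω : Type} [MeasureSpace Ω]
    [IsProbabilityMeasure (ℙ : Measure Ω)] (Z : ℕ → Ω → F₂)
    (hindep : iIndepFun (m := fun _ => (inferInstance : MeasurableSpace F₂)) Z ℙ)
    (hlaw : ∀ i, Measure.map (Z i) ℙ = ν) (hZ : ∀ i, AEMeasurable (Z i) (ℙ : Measure Ω)) (n : ℕ) :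
    Measure.map (walk Z n) ℙ = convPow ν n := by
  induction n with
  | zero =>
    have : walk Z 0 = fun _ => 1 := rfl
    rw [this, Measure.map_const]
    simp [convPow]
  | succ n ih =>
    have hw : walk Z (n + 1) = walk Z n * Z (n + 1) := by
      funext x; simp [walk, List.range_succ]
    rw [hw, IndepFun.map_mul_eq_map_mconv_map₀ (aemeasurable_walk hZ n) (hZ _), ih, hlaw,
      convPow]
    have h := hindep.indepFun_finset₀ (Finset.Icc 1 n) {n + 1} (by simp) hZ
    let φ : ((i : Finset.Icc 1 n) → F₂) → F₂ := fun v =>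
      ((List.range n).map fun i =>
        if hi : i + 1 ∈ Finset.Icc 1 n then v ⟨i + 1, hi⟩ else 1).prod
    let ψ : ((i : ({n + 1} : Finset ℕ)) → F₂) → F₂ := fun v => v ⟨n + 1, by simp⟩
    have hφ : Measurable φ := by
      have h1 : ∀ l : List ℕ, Measurable fun v : ((i : Finset.Icc 1 n) → F₂) =>
          (l.map fun i => if hi : i + 1 ∈ Finset.Icc 1 n then v ⟨i + 1, hi⟩ else 1).prod := by
        intro l
        induction l with
        | nil => exact measurable_const
        | cons i l ih =>
          simp only [List.map_cons, List.prod_cons]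
          refine Measurable.mul ?_ ih
          by_cases hi : i + 1 ∈ Finset.Icc 1 n
          · simpa only [dif_pos hi] using measurable_pi_apply _
          · simpa only [dif_neg hi] using measurable_const
      exact h1 _
    have hψ : Measurable ψ :=
      measurable_pi_apply (X := fun _ : ({n + 1} : Finset ℕ) => F₂) ⟨n + 1, by simp⟩
    have := h.comp (φ := φ) (ψ := ψ) hφ hψ
    convert this using 1
    · funext x
      simp only [φ, walk, Function.comp]
      congr 1
      refine List.map_congr_left fun i hi => ?_
      rw [dif_pos]
      simpa using hi
    · rfl

/-- Borel–Cantelli for the random walk. -/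
lemma ae_eventually_walk_notMem (ν : Measure F₂) [IsProbabilityMeasure ν] {Ω : Type}
    [MeasureSpace Ω] [IsProbabilityMeasure (ℙ : Measure Ω)] (Z : ℕ → Ω → F₂)
    (hindep : iIndepFun (m := fun _ => (inferInstance : MeasurableSpace F₂)) Z ℙ)
    (hlaw : ∀ i, Measure.map (Z i) ℙ = ν) (P : Set F₂)
    (hP : ∑' n, (avg ν)^[n] (P.indicator 1) 1 ≠ ∞) :
    ∀ᵐ x ∂(ℙ : Measure Ω), ∀ᶠ n in atTop, walk Z n x ∉ P := by
  have hZ : ∀ i, AEMeasurable (Z i) (ℙ : Measure Ω) := fun i =>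
    AEMeasurable.of_map_ne_zero (by rw [hlaw]; exact IsProbabilityMeasure.ne_zero ν)
  refine ae_eventually_notMem (s := fun n => {x | walk Z n x ∈ P}) ?_
  convert hP using 3 with n
  rw [avg_iterate]
  simp only [avg, one_mul]
  rw [lintegral_indicator_one .of_discrete, ← map_walk ν Z hindep hlaw hZ,
    Measure.map_apply_of_aemeasurable (aemeasurable_walk hZ n) .of_discrete]
  rfl

open Matrix

section Cones

/-- The standard area form on the plane. -/
def wedge (u v : Fin 2 → ℝ) : ℝ := u 0 * v 1 - u 1 * v 0

lemma wedge_self (u : Fin 2 → ℝ) : wedge u u = 0 := by unfold wedge; ring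

lemma wedge_comm (u v : Fin 2 → ℝ) : wedge u v = -wedge v u := by unfold wedge; ring

@[simp] lemma wedge_add (u v w : Fin 2 → ℝ) : wedge u (v + w) = wedge u v + wedge u w := by
  simp only [wedge, Pi.add_apply]; ring

@[simp] lemma wedge_smul (c : ℝ) (u v : Fin 2 → ℝ) : wedge u (c • v) = c * wedge u v := by
  simp only [wedge, Pi.smul_apply, smul_eq_mul]; ring

@[simp] lemma add_wedge (u v w : Fin 2 → ℝ) : wedge (u + v) w = wedge u w + wedge v w := by
  simp only [wedge, Pi.add_apply]; ring

@[simp] lemma smul_wedge (c : ℝ) (u v : Fin 2 → ℝ) : wedge (c • u) v = c * wedge u v := by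
  simp only [wedge, Pi.smul_apply, smul_eq_mul]; ring

lemma wedge_mulVec (A : Matrix (Fin 2) (Fin 2) ℝ) (u v : Fin 2 → ℝ) :
    wedge (A *ᵥ u) (A *ᵥ v) = A.det * wedge u v := by
  simp only [wedge, mulVec, dotProduct, Fin.sum_univ_two, det_fin_two]; ring

lemma wedge_cramer (u v w : Fin 2 → ℝ) :
    wedge u v • w = wedge w v • u + wedge u w • v := by
  funext i
  fin_cases i <;> simp [wedge] <;> ring

lemma eq_zero_of_wedge {u v w : Fin 2 → ℝ} (huv : wedge u v ≠ 0) (hu : wedge u w = 0)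
    (hv : wedge w v = 0) : w = 0 := by
  have := wedge_cramer u v w
  rw [hu, hv, zero_smul, zero_smul, add_zero] at this
  exact (smul_eq_zero.1 this).resolve_left huv

lemma wedge_eq_zero_of {u v w : Fin 2 → ℝ} (hu : u ≠ 0) (hv : wedge u v = 0)
    (hw : wedge u w = 0) : wedge v w = 0 := by
  by_contra h
  exact hu (eq_zero_of_wedge h (by rw [wedge_comm, hv, neg_zero]) hw)

lemma exists_wedge_eq_one {u : Fin 2 → ℝ} (hu : u ≠ 0) : ∃ z, wedge u z = 1 := by
  by_cases h0 : u 0 = 0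
  · have h1 : u 1 ≠ 0 := fun h1 => hu (by funext i; fin_cases i <;> simpa)
    exact ⟨![-(u 1)⁻¹, 0], by simp [wedge, h1]⟩
  · exact ⟨![0, (u 0)⁻¹], by simp [wedge, h0]⟩

lemma exists_eq_smul {u v : Fin 2 → ℝ} (hu : u ≠ 0) (h : wedge u v = 0) : ∃ c : ℝ, v = c • u := by
  obtain ⟨z, hz⟩ := exists_wedge_eq_one hu
  refine ⟨wedge v z, ?_⟩
  have := wedge_cramer u z v
  rwa [hz, h, zero_smul, add_zero, one_smul] at this

lemma mulVec_ne_zero {A : Matrix (Fin 2) (Fin 2) ℝ} (hA : A.det = 1) {v : Fin 2 → ℝ}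
    (hv : v ≠ 0) : A *ᵥ v ≠ 0 := by
  obtain ⟨z, hz⟩ := exists_wedge_eq_one hv
  intro h
  have := wedge_mulVec A v z
  rw [h, hA, hz] at this
  simp [wedge] at this

/-- The closed double cone of nonzero vectors between the lines spanned by `e` and `f`,
consisting of the vectors whose coordinates in the basis `e, f` have the same sign. -/
def cone (e f : Fin 2 → ℝ) : Set (Fin 2 → ℝ) := {v | v ≠ 0 ∧ 0 ≤ wedge e v * wedge v f}

/-- If a cone meets the preimage of another cone without being contained in it, then it meets
the preimage of the boundary. -/
lemma exists_boundary {e f e' f' : Fin 2 → ℝ} (hef : wedge e f ≠ 0)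
    {A : Matrix (Fin 2) (Fin 2) ℝ} (hA : A.det = 1) {v w : Fin 2 → ℝ}
    (hv : v ∈ cone e f) (hw : w ∈ cone e f) (hAv : A *ᵥ v ∈ cone e' f')
    (hAw : A *ᵥ w ∉ cone e' f') :
    ∃ z ∈ cone e f, wedge e' (A *ᵥ z) * wedge (A *ᵥ z) f' = 0 := by
  have half : ∀ {v}, v ∈ cone e f → ∃ c : ℝ, c ≠ 0 ∧ 0 ≤ wedge e (c • v) ∧ 0 ≤ wedge (c • v) f := by
    rintro v ⟨-, h⟩
    rcases mul_nonneg_iff.1 h with h | h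
    · exact ⟨1, one_ne_zero, by simpa using h⟩
    · exact ⟨-1, by norm_num, by simpa only [wedge_smul, smul_wedge, neg_mul, one_mul, neg_nonneg]
        using h⟩
  obtain ⟨c, hc, hc1, hc2⟩ := half hv
  obtain ⟨d, hd, hd1, hd2⟩ := half hw
  have hAw' : wedge e' (A *ᵥ w) * wedge (A *ᵥ w) f' < 0 := by
    by_contra h
    exact hAw ⟨mulVec_ne_zero hA hw.1, not_lt.1 h⟩
  let z : ℝ → (Fin 2 → ℝ) := fun t => (1 - t) • c • v + t • d • w
  let F : ℝ → ℝ := fun t => wedge e' (A *ᵥ z t) * wedge (A *ᵥ z t) f'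
  have hF : Continuous F := by
    simp only [F, z, mulVec_add, mulVec_smul, wedge_add, add_wedge, wedge_smul, smul_wedge]
    fun_prop
  have h0 : 0 ≤ F 0 := by
    have : F 0 = c ^ 2 * (wedge e' (A *ᵥ v) * wedge (A *ᵥ v) f') := by
      simp only [F, z, sub_zero, one_smul, zero_smul, add_zero, mulVec_smul, wedge_smul,
        smul_wedge]
      ring
    rw [this]
    exact mul_nonneg (sq_nonneg _) hAv.2
  have h1 : F 1 ≤ 0 := by
    have : F 1 = d ^ 2 * (wedge e' (A *ᵥ w) * wedge (A *ᵥ w) f') := by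
      simp only [F, z, sub_self, one_smul, zero_smul, zero_add, mulVec_smul, wedge_smul,
        smul_wedge]
      ring
    rw [this]
    exact mul_nonpos_of_nonneg_of_nonpos (sq_nonneg _) hAw'.le
  obtain ⟨t, ⟨ht0, ht1⟩, ht⟩ := intermediate_value_Icc' zero_le_one hF.continuousOn ⟨h1, h0⟩
  refine ⟨z t, ⟨fun hz => ?_, ?_⟩, ht⟩
  · have ez : wedge e (z t) = (1 - t) * wedge e (c • v) + t * wedge e (d • w) := by simp [z]
    have fz : wedge (z t) f = (1 - t) * wedge (c • v) f + t * wedge (d • w) f := by simp [z]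
    have ez0 : wedge e (z t) = 0 := by rw [hz]; simp [wedge]
    have fz0 : wedge (z t) f = 0 := by rw [hz]; simp [wedge]
    rw [ez] at ez0
    rw [fz] at fz0
    have a1 := mul_nonneg (sub_nonneg.2 ht1) hc1
    have a2 := mul_nonneg ht0 hd1
    have a3 := mul_nonneg (sub_nonneg.2 ht1) hc2
    have a4 := mul_nonneg ht0 hd2
    have b1 : (1 - t) * wedge e (c • v) = 0 := by linarith
    have b2 : t * wedge e (d • w) = 0 := by linarith
    have b3 : (1 - t) * wedge (c • v) f = 0 := by linarith
    have b4 : t * wedge (d • w) f = 0 := by linarith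
    by_cases htt : t = 0
    · subst htt
      simp only [sub_zero, one_mul] at b1 b3
      exact (smul_ne_zero hc hv.1) (eq_zero_of_wedge hef b1 b3)
    · exact (smul_ne_zero hd hw.1) (eq_zero_of_wedge hef ((mul_eq_zero.1 b2).resolve_left htt)
        ((mul_eq_zero.1 b4).resolve_left htt))
  · simp only [z, wedge_add, add_wedge, wedge_smul (_ - _), wedge_smul t, smul_wedge (_ - _),
      smul_wedge t]
    have : 0 ≤ 1 - t := sub_nonneg.2 ht1
    positivity

/-- A matrix of determinant one mapping a closed cone into its interior is hyperbolic. -/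
lemma trace_sq_gt_of_cone {e f : Fin 2 → ℝ} (hef : wedge e f ≠ 0)
    {A : Matrix (Fin 2) (Fin 2) ℝ} (hA : A.det = 1)
    (h : ∀ v ∈ cone e f, 0 < wedge e (A *ᵥ v) * wedge (A *ᵥ v) f) : 4 < A.trace ^ 2 := by
  set p := wedge (A *ᵥ e) f with hp
  set r := wedge e (A *ᵥ e) with hr
  set q := wedge (A *ᵥ f) f with hq
  set s := wedge e (A *ᵥ f) with hs
  have htr : A.trace * wedge e f = p + s := by
    simp only [hp, hs, wedge, mulVec, dotProduct, Fin.sum_univ_two, trace_fin_two]; ring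
  have hdet : p * s - q * r = wedge e f ^ 2 := by
    have := wedge_mulVec A e f
    rw [hA, one_mul] at this
    rw [sq]
    nth_rewrite 1 [← this]
    simp only [hp, hq, hr, hs, wedge]; ring
  have hcomb : ∀ a b : ℝ, 0 ≤ a → 0 ≤ b → (a ≠ 0 ∨ b ≠ 0) → 0 < (a * r + b * s) * (a * p + b * q) := by
    intro a b ha hb hab
    have := h (a • e + b • f) ⟨fun h0 => ?_, ?_⟩
    · simpa only [mulVec_add, mulVec_smul, wedge_add, wedge_smul, add_wedge, smul_wedge] using this
    · have h1 : wedge e (a • e + b • f) = b * wedge e f := by simp [wedge_self]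
      have h2 : wedge (a • e + b • f) f = a * wedge e f := by simp [wedge_self]
      rw [h0] at h1 h2
      simp only [wedge, Pi.zero_apply, mul_zero, zero_mul, sub_zero] at h1 h2
      rcases hab with hab | hab
      · exact mul_ne_zero hab hef h2.symm
      · exact mul_ne_zero hab hef h1.symm
    · simp only [wedge_add, add_wedge, wedge_smul, smul_wedge, wedge_self]
      have : 0 ≤ a * b * wedge e f ^ 2 := by positivity
      linarith
  have h10 : 0 < r * p := by simpa using hcomb 1 0 (by simp) (by simp) (by simp)
  have h01 : 0 < s * q := by simpa using hcomb 0 1 (by simp) (by simp) (by simp)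
  have hpq : 0 < p * q := by
    by_contra hpq
    have hp0 : p ≠ 0 := right_ne_zero_of_mul h10.ne'
    have h1 := hcomb |q| |p| (abs_nonneg _) (abs_nonneg _) (Or.inr (by simpa using hp0))
    have h2 : |q| * p + |p| * q = 0 := by
      rcases lt_trichotomy p 0 with hp | hp | hp
      · rw [abs_of_neg hp, abs_of_nonneg (by nlinarith)]; ring
      · exact absurd hp hp0
      · rw [abs_of_pos hp, abs_of_nonpos (by nlinarith)]; ring
    rw [h2, mul_zero] at h1
    exact h1.false
  have hqr : 0 < q * r := by
    have : 0 < (q * r) * p ^ 2 := by nlinarith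
    exact (mul_pos_iff_of_pos_right (by have := right_ne_zero_of_mul h10.ne'; positivity)).1 this
  have hD : 0 < wedge e f ^ 2 := by positivity
  have : 4 * wedge e f ^ 2 < A.trace ^ 2 * wedge e f ^ 2 := by
    rw [← mul_pow, htr]
    nlinarith [sq_nonneg (p - s)]
  exact lt_of_mul_lt_mul_right this hD.le

end Cones

section Representation

variable {ι G : Type*} [Group G]

/-- A family of group elements acting on the plane like a Schottky family: `s i` maps the
complement of the cone `(e' i, f' i)` into the interior of the cone `(e i, f i)`. -/
structure Schottky (ρ : G →* Matrix (Fin 2) (Fin 2) ℝ) (s : ι → G)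
    (e f e' f' : ι → Fin 2 → ℝ) : Prop where
  det_eq : ∀ g, (ρ g).det = 1
  wedge_ne : ∀ i, wedge (e i) (f i) ≠ 0
  ne_zero : ∀ i, e' i ≠ 0 ∧ f' i ≠ 0
  disjoint : ∀ i j v, v ∈ cone (e i) (f i) → v ∈ cone (e j) (f j) → i = j
  disjoint' : ∀ i j v, v ∈ cone (e' i) (f' i) → v ∈ cone (e' j) (f' j) → i = j
  maps : ∀ i v, v ≠ 0 → v ∉ cone (e' i) (f' i) →
    0 < wedge (e i) (ρ (s i) *ᵥ v) * wedge (ρ (s i) *ᵥ v) (f i)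

variable {ρ : G →* Matrix (Fin 2) (Fin 2) ℝ} {s : ι → G} {e f e' f' : ι → Fin 2 → ℝ}

/-- The pairs of labels for which `g` fails to separate the target cone from the source cone. -/
def Meets (ρ : G →* Matrix (Fin 2) (Fin 2) ℝ) (e f e' f' : ι → Fin 2 → ℝ)
    (g : G) (i j : ι) : Prop :=
  ∃ v ∈ cone (e j) (f j), ρ g *ᵥ v ∈ cone (e' i) (f' i)

lemma Schottky.ncard_meets_le [Fintype ι] (h : Schottky ρ s e f e' f') (g : G) :
    {p : ι × ι | Meets ρ e f e' f' g p.1 p.2}.ncard ≤ 3 * Fintype.card ι := by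
  classical
  let T : ι × ι → Bool → Prop := fun p c => ∃ v ∈ cone (e p.2) (f p.2),
    if c then wedge (e' p.1) (ρ g *ᵥ v) = 0 else wedge (f' p.1) (ρ g *ᵥ v) = 0
  let F : ι × ι → (ι × Bool) ⊕ ι := fun p =>
    if T p true then Sum.inl (p.1, true) else if T p false then Sum.inl (p.1, false) else Sum.inr p.2
  have hT : ∀ i j j' c, T (i, j) c → T (i, j') c → j = j' := by
    rintro i j j' c ⟨v, hv, hvc⟩ ⟨w, hw, hwc⟩
    have hvw : wedge (ρ g *ᵥ v) (ρ g *ᵥ w) = 0 := by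
      cases c
      · exact wedge_eq_zero_of (h.ne_zero i).2 hvc hwc
      · exact wedge_eq_zero_of (h.ne_zero i).1 hvc hwc
    rw [wedge_mulVec, h.det_eq, one_mul] at hvw
    obtain ⟨c, rfl⟩ := exists_eq_smul hv.1 hvw
    refine h.disjoint j j' v hv ⟨hv.1, ?_⟩
    have := hw.2
    have hc : c ≠ 0 := fun hc => hw.1 (by simp [hc])
    simp only [wedge_smul, smul_wedge] at this
    have h2 : 0 < c ^ 2 := by positivity
    refine (mul_nonneg_iff_of_pos_left h2).1 ?_
    linarith
  have hF : Set.InjOn F {p : ι × ι | Meets ρ e f e' f' g p.1 p.2} := by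
    have key : ∀ p : ι × ι, Meets ρ e f e' f' g p.1 p.2 → ¬ T p true → ¬ T p false →
        ∀ v ∈ cone (e p.2) (f p.2), ρ g *ᵥ v ∈ cone (e' p.1) (f' p.1) := by
      rintro p ⟨v, hv, hgv⟩ h1 h2 w hw
      by_contra hgw
      obtain ⟨z, hz, hz0⟩ := exists_boundary (h.wedge_ne _) (h.det_eq g) hv hw hgv hgw
      rcases mul_eq_zero.1 hz0 with hz0 | hz0
      · exact h1 ⟨z, hz, by simpa using hz0⟩
      · exact h2 ⟨z, hz, by simp [-mulVec_fin_two, wedge_comm (f' _), hz0]⟩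
    rintro ⟨i, j⟩ hp ⟨i', j'⟩ hq hpq
    simp only [F] at hpq
    split_ifs at hpq with h1 h2 h3 h4 h5 h6
    · cases hpq; rw [hT _ _ _ _ h1 h2]
    · cases hpq
    · cases hpq
    · cases hpq; rw [hT _ _ _ _ h4 h6]
    · cases hpq
      obtain ⟨v, hv, hgv⟩ := hp
      rw [h.disjoint' i i' _ hgv (key _ hq ‹_› ‹_› v hv)]
  calc _ ≤ (Set.univ : Set ((ι × Bool) ⊕ ι)).ncard :=
        Set.ncard_le_ncard_of_injOn F (fun _ _ => Set.mem_univ _) hF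
    _ = 3 * Fintype.card ι := by
        rw [Set.ncard_univ, Nat.card_eq_fintype_card]
        simp
        ring

lemma Schottky.maps_chain (h : Schottky ρ s e f e' f') (v : List (ι × G)) (p q : ι × G)
    (hc : GoodChain (Meets ρ e f e' f') (p :: v ++ [q])) (x : Fin 2 → ℝ)
    (hx : x ∈ cone (e q.1) (f q.1)) :
    0 < wedge (e p.1) (ρ (prodRight s (p :: v)) *ᵥ x) *
      wedge (ρ (prodRight s (p :: v)) *ᵥ x) (f p.1) := by
  induction v generalizing p with
  | nil =>
    have h1 : ¬ Meets ρ e f e' f' p.2 p.1 q.1 := by simpa [GoodChain] using hc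
    have := h.maps p.1 (ρ p.2 *ᵥ x) (mulVec_ne_zero (h.det_eq _) hx.1) fun h2 => h1 ⟨x, hx, h2⟩
    simpa only [prodRight, mul_one, map_mul, mulVec_mulVec] using this
  | cons p' v ih =>
    have hc' := List.isChain_cons_cons.1 hc
    have h2 := ih p' hc'.2
    set y := ρ (prodRight s (p' :: v)) *ᵥ x with hy
    have hy0 : y ∈ cone (e p'.1) (f p'.1) := ⟨mulVec_ne_zero (h.det_eq _) hx.1, h2.le⟩
    have := h.maps p.1 (ρ p.2 *ᵥ y) (mulVec_ne_zero (h.det_eq _) hy0.1)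
      fun h2 => hc'.1 ⟨y, hy0, h2⟩
    rw [prodRight, map_mul, ← mulVec_mulVec, ← hy, map_mul, ← mulVec_mulVec]
    exact this

lemma Schottky.trace_sq_gt (h : Schottky ρ s e f e' f') (v : List (ι × G)) (p : ι × G)
    (hc : GoodChain (Meets ρ e f e' f') (p :: v ++ [p])) :
    4 < (ρ (prodRight s (p :: v))).trace ^ 2 :=
  trace_sq_gt_of_cone (h.wedge_ne p.1) (h.det_eq _) fun x hx => h.maps_chain v p p hc x hx

lemma Schottky.labelSum_le [Fintype ι] (h : Schottky ρ s e f e' f') {β : ℝ≥0∞}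
    (hβ : 3 * (Fintype.card ι : ℝ≥0∞) ≤ β ^ 2) (hβ1 : 1 ≤ β) (L : List G) (g : G) :
    labelSum L (fun w : List (ι × G) =>
        {g | (ρ g).trace ^ 2 = 4}.indicator (1 : G → ℝ≥0∞) (prodLeft s w * g)) ≤
      (Fintype.card ι + 1) * (2 * β) ^ L.length := by
  classical
  have := zipCount_le (s := s) (bad := Meets ρ e f e' f') (P := {g | (ρ g).trace ^ 2 = 4}) (β := β)
    (fun x g hx => by
      have : (ρ (g * x * g⁻¹)).trace = (ρ x).trace := by
        rw [map_mul, trace_mul_comm, ← map_mul]; simp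
      rw [Set.mem_ofPred_eq] at hx ⊢
      rwa [this])
    h.ncard_meets_le hβ hβ1 (fun p v hc hP => (h.trace_sq_gt v p hc).ne' hP) L g []
  convert this using 1
  · simp only [zipCount, labelSum, prodRight, mul_one, GoodChain, List.isChain_nil, true_and,
      Set.indicator_apply, Pi.one_apply]
  · simp

end Representation

section Dynamics

open Topology

lemma wedge_cone_mul (u z v : Fin 2 → ℝ) (δ : ℝ) :
    wedge (u + δ • z) v * wedge v (u + (-δ) • z) = (δ * wedge z v) ^ 2 - wedge u v ^ 2 := by
  rw [wedge_add, wedge_smul, add_wedge, smul_wedge, wedge_comm v u, wedge_comm v z]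
  ring

lemma abs_wedge_le (u v : Fin 2 → ℝ) : |wedge u v| ≤ (|u 0| + |u 1|) * (|v 0| + |v 1|) := by
  unfold wedge
  refine (abs_sub _ _).trans ?_
  rw [abs_mul, abs_mul]
  nlinarith [abs_nonneg (u 0), abs_nonneg (u 1), abs_nonneg (v 0), abs_nonneg (v 1),
    mul_nonneg (abs_nonneg (u 0)) (abs_nonneg (v 0)), mul_nonneg (abs_nonneg (u 1)) (abs_nonneg (v 1))]

/-- Narrow cones around distinct lines are disjoint. -/
lemma eventually_disjoint_cone {u₁ z₁ u₂ z₂ : Fin 2 → ℝ} (h : wedge u₁ u₂ ≠ 0) :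
    ∀ᶠ δ : ℝ in 𝓝[>] 0, ∀ v, v ∈ cone (u₁ + δ • z₁) (u₁ + (-δ) • z₁) →
      v ∉ cone (u₂ + δ • z₂) (u₂ + (-δ) • z₂) := by
  set K : ℝ := (|u₁ 0| + |u₁ 1|) * (|z₂ 0| + |z₂ 1|) + (|u₂ 0| + |u₂ 1|) * (|z₁ 0| + |z₁ 1|)
  have hK : Tendsto (fun δ : ℝ => δ * K) (𝓝[>] 0) (𝓝 0) := by
    have : Tendsto (fun δ : ℝ => δ * K) (𝓝 0) (𝓝 (0 * K)) := tendsto_id.mul_const K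
    rw [zero_mul] at this
    exact this.mono_left nhdsWithin_le_nhds
  filter_upwards [hK.eventually_lt_const (abs_pos.2 h), self_mem_nhdsWithin] with δ hδ hδ0 v h1 h2
  have hδ0 : 0 < δ := hδ0
  have hv := h1.1
  have a1 : |wedge u₁ v| ≤ δ * |wedge z₁ v| := by
    have := h1.2
    rw [wedge_cone_mul, sub_nonneg] at this
    simpa [abs_mul, abs_of_pos hδ0] using sq_le_sq.1 this
  have a2 : |wedge u₂ v| ≤ δ * |wedge z₂ v| := by
    have := h2.2
    rw [wedge_cone_mul, sub_nonneg] at this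
    simpa [abs_mul, abs_of_pos hδ0] using sq_le_sq.1 this
  set m := |v 0| + |v 1| with hm
  have hm0 : 0 < m := by
    by_contra hm0
    have := abs_nonneg (v 0)
    have := abs_nonneg (v 1)
    refine hv (funext fun i => ?_)
    fin_cases i
    · exact abs_eq_zero.1 (show |v 0| = 0 by linarith)
    · exact abs_eq_zero.1 (show |v 1| = 0 by linarith)
  have b1 : |wedge u₁ v| ≤ δ * ((|z₁ 0| + |z₁ 1|) * m) :=
    a1.trans (mul_le_mul_of_nonneg_left (abs_wedge_le _ _) hδ0.le)
  have b2 : |wedge u₂ v| ≤ δ * ((|z₂ 0| + |z₂ 1|) * m) :=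
    a2.trans (mul_le_mul_of_nonneg_left (abs_wedge_le _ _) hδ0.le)
  have key : ∀ k, |wedge u₁ u₂| * |v k| ≤ |wedge u₂ v| * |u₁ k| + |wedge u₁ v| * |u₂ k| := by
    intro k
    have := congrFun (wedge_cramer u₁ u₂ v) k
    simp only [Pi.smul_apply, Pi.add_apply, smul_eq_mul] at this
    rw [← abs_mul, this, wedge_comm v u₂]
    refine (abs_add_le _ _).trans ?_
    rw [abs_mul, abs_mul, abs_neg]
  have k0 := key 0
  have k1 := key 1
  have c1 := mul_le_mul_of_nonneg_right b1 (add_nonneg (abs_nonneg (u₂ 0)) (abs_nonneg (u₂ 1)))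
  have c2 := mul_le_mul_of_nonneg_right b2 (add_nonneg (abs_nonneg (u₁ 0)) (abs_nonneg (u₁ 1)))
  have : |wedge u₁ u₂| * m ≤ (δ * K) * m := by
    simp only [K]
    rw [hm] at c1 c2 ⊢
    nlinarith
  exact hδ.not_ge (le_of_mul_le_mul_right this hm0)

/-- Matrices converging projectively to a rank one map eventually map the complement of a cone
around the kernel into the interior of a cone around the image. -/
lemma eventually_maps_cone {M : ℕ → Matrix (Fin 2) (Fin 2) ℝ} {c : ℕ → ℝ}
    {u r z z' : Fin 2 → ℝ} (hu : wedge u z = 1) (hr : wedge r z' = 1) {δ : ℝ} (hδ : 0 < δ)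
    (h : ∀ v, Tendsto (fun n => c n • (M n *ᵥ v)) atTop (𝓝 (wedge r v • u))) :
    ∀ᶠ n in atTop, ∀ v, v ≠ 0 → v ∉ cone (r + δ • z') (r + (-δ) • z') →
      0 < wedge (u + δ • z) (M n *ᵥ v) * wedge (M n *ᵥ v) (u + (-δ) • z) := by
  have hw : ∀ a v, Tendsto (fun n => wedge a (c n • (M n *ᵥ v))) atTop
      (𝓝 (wedge r v * wedge a u)) := by
    intro a v
    have hc : Continuous (wedge a) := by unfold wedge; fun_prop
    have := (hc.tendsto _).comp (h v)
    rwa [wedge_smul] at this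
  have hA := hw u r
  have hB := hw u z'
  have hC := hw z r
  have hD := hw z z'
  rw [wedge_self, zero_mul] at hA hC
  rw [wedge_self, mul_zero] at hB
  rw [hr, wedge_comm, hu, one_mul] at hD
  have hA := hA.abs.eventually_lt_const (show |(0 : ℝ)| < δ ^ 2 / 8 by simpa using by positivity)
  have hB := hB.abs.eventually_lt_const (show |(0 : ℝ)| < δ / 8 by simpa using by positivity)
  have hC := hC.abs.eventually_lt_const (show |(0 : ℝ)| < δ / 4 by simpa using by positivity)
  have hD := hD.eventually_lt_const (show (-1 : ℝ) < -(3 / 4) by norm_num)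
  filter_upwards [hA, hB, hC, hD] with n hA hB hC hD v hv hvc
  have hab : (δ * wedge z' v) ^ 2 < wedge r v ^ 2 := by
    by_contra hh
    refine hvc ⟨hv, ?_⟩
    rw [wedge_cone_mul]
    linarith
  have hv' := wedge_cramer r z' v
  rw [hr, one_smul, wedge_comm v z'] at hv'
  set a := wedge r v
  set b := wedge z' v
  set M' := c n • M n with hM'
  rw [wedge_cone_mul, sub_pos]
  have hsm : ∀ w, c n • (M n *ᵥ w) = M' *ᵥ w := fun w => by rw [hM', smul_mulVec]
  rw [hsm] at hA hB hC hD
  have e : ∀ w, c n * wedge w (M n *ᵥ v) = -b * wedge w (M' *ᵥ r) + a * wedge w (M' *ᵥ z') := by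
    intro w
    rw [← wedge_smul, hsm, hv', mulVec_add, mulVec_smul, mulVec_smul, wedge_add, wedge_smul,
      wedge_smul]
  have eu := e u
  have ez := e z
  set A := wedge u (M' *ᵥ r)
  set B := wedge u (M' *ᵥ z')
  set C := wedge z (M' *ᵥ r)
  set D := wedge z (M' *ᵥ z')
  have hab' : δ * |b| < |a| := by
    have := sq_lt_sq.1 hab
    rwa [abs_mul, abs_of_pos hδ] at this
  have hb0 := abs_nonneg b
  have ha0 : 0 < |a| := lt_of_le_of_lt (by positivity) hab'
  have u1 : |-b * A + a * B| ≤ |a| * δ / 4 := by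
    refine (abs_add_le _ _).trans ?_
    rw [abs_mul, abs_mul, abs_neg]
    have := mul_le_mul_of_nonneg_left hA.le hb0
    have := mul_le_mul_of_nonneg_left hB.le ha0.le
    nlinarith
  have z1 : |a| / 2 ≤ |-b * C + a * D| := by
    have h1 : |a * D| ≤ |-b * C + a * D| + |b * C| := by
      have := abs_add_le (-b * C + a * D) (b * C)
      rwa [show -b * C + a * D + b * C = a * D by ring] at this
    rw [abs_mul, abs_mul, abs_of_neg (show D < 0 by linarith)] at h1
    have := mul_le_mul_of_nonneg_left hC.le hb0
    have := mul_le_mul_of_nonneg_left hD.le ha0.le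
    nlinarith
  have key : (-b * A + a * B) ^ 2 < (δ * (-b * C + a * D)) ^ 2 := by
    rw [sq_lt_sq, abs_mul, abs_of_pos hδ]
    have := mul_le_mul_of_nonneg_left z1 hδ.le
    have := mul_pos ha0 hδ
    linarith
  rw [← eu, ← ez] at key
  have : c n ^ 2 * wedge u (M n *ᵥ v) ^ 2 < c n ^ 2 * (δ * wedge z (M n *ᵥ v)) ^ 2 := by
    convert key using 1 <;> ring
  exact lt_of_mul_lt_mul_left this (sq_nonneg _)

/-- The sequence `0, 1, t, t² - 1, …` of Chebyshev type expressing the powers of a matrix of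
determinant one and trace `t`. -/
def cheb (t : ℝ) : ℕ → ℝ
  | 0 => 0
  | 1 => 1
  | n + 2 => t * cheb t (n + 1) - cheb t n

lemma cheb_step {t : ℝ} (ht : 2 ≤ t) (n : ℕ) : 0 ≤ cheb t n ∧ cheb t n + 1 ≤ cheb t (n + 1) := by
  induction n with
  | zero => simp [cheb]
  | succ n ih => rw [cheb]; exact ⟨by linarith, by nlinarith⟩

lemma cheb_ge {t : ℝ} (ht : 2 ≤ t) (n : ℕ) : (n : ℝ) ≤ cheb t n := by
  induction n with
  | zero => simp [cheb]
  | succ n ih => have := (cheb_step ht n).2; push_cast; linarith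

lemma cheb_invariant (t : ℝ) (n : ℕ) :
    cheb t (n + 1) ^ 2 - t * cheb t (n + 1) * cheb t n + cheb t n ^ 2 = 1 := by
  induction n with
  | zero => simp [cheb]
  | succ n ih => rw [cheb]; linear_combination ih

lemma pow_succ_eq_cheb {X : Matrix (Fin 2) (Fin 2) ℝ} (hX : X.det = 1) (n : ℕ) :
    X ^ (n + 1) = cheb X.trace (n + 1) • X - cheb X.trace n • 1 := by
  induction n with
  | zero => simp [cheb]
  | succ n ih =>
    have hX2 : X * X = X.trace • X - (1 : Matrix (Fin 2) (Fin 2) ℝ) := by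
      rw [det_fin_two] at hX
      ext i j
      fin_cases i <;> fin_cases j <;>
        simp [Matrix.mul_apply, Fin.sum_univ_two, trace_fin_two] <;>
        first | ring1 | linear_combination -hX
    rw [pow_succ, ih, sub_mul, smul_mul_assoc, hX2, smul_mul_assoc, one_mul]
    conv_rhs => rw [cheb]
    module

lemma wedge_pow_ne_zero {X : Matrix (Fin 2) (Fin 2) ℝ} (hX : X.det = 1) (ht : 2 ≤ X.trace)
    {w : Fin 2 → ℝ} (hw : wedge w (X *ᵥ w) ≠ 0) (n : ℕ) : wedge w (X ^ (n + 1) *ᵥ w) ≠ 0 := by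
  rw [pow_succ_eq_cheb hX, sub_mulVec, smul_mulVec, smul_mulVec, one_mulVec, sub_eq_add_neg,
    ← neg_smul, wedge_add, wedge_smul, wedge_smul, wedge_self, mul_zero, add_zero]
  have := cheb_step ht n
  exact mul_ne_zero (by linarith) hw

/-- The projective limit of the powers of a non-scalar matrix of determinant one and trace at
least two is a rank one map. -/
lemma exists_rank_one_limit {X : Matrix (Fin 2) (Fin 2) ℝ} (hX : X.det = 1) (ht : 2 ≤ X.trace)
    (hns : ∀ c : ℝ, X ≠ c • 1) : ∃ (c : ℕ → ℝ) (u r : Fin 2 → ℝ), u ≠ 0 ∧ r ≠ 0 ∧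
      wedge u (X *ᵥ u) = 0 ∧ wedge r (X *ᵥ r) = 0 ∧
      ∀ v, Tendsto (fun n => c n • (X ^ (n + 1) *ᵥ v)) atTop (𝓝 (wedge r v • u)) := by
  set t := X.trace with htX
  set μ := (t - √(t ^ 2 - 4)) / 2 with hμ
  have hs : √(t ^ 2 - 4) ^ 2 = t ^ 2 - 4 := Real.sq_sqrt (by nlinarith)
  have hs0 := Real.sqrt_nonneg (t ^ 2 - 4)
  have hquad : μ ^ 2 - t * μ + 1 = 0 := by rw [hμ]; linear_combination hs / 4
  have hμt : 2 * μ ≤ t := by rw [hμ]; linarith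
  have hμ1 : μ ≤ 1 := by
    by_contra! h
    nlinarith [mul_le_mul_of_nonneg_left hμt (zero_le_one.trans h.le)]
  have hlim : Tendsto (fun n => cheb t n / cheb t (n + 1)) atTop (𝓝 μ) := by
    have hb : ∀ n : ℕ, |cheb t n / cheb t (n + 1) - μ| ≤ 1 / ((n : ℝ) + 1) := by
      intro n
      obtain ⟨h0, h1⟩ := cheb_step ht n
      have hpos : 0 < cheb t (n + 1) := by linarith
      have hge : (n : ℝ) + 1 ≤ cheb t (n + 1) := by exact_mod_cast cheb_ge ht (n + 1)
      have hinv := cheb_invariant t n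
      set ρ := cheb t n / cheb t (n + 1) with hρ
      have hρ1 : ρ ≤ 1 := (div_le_one hpos).2 (by linarith)
      have hρq : ρ ^ 2 - t * ρ + 1 = (1 / cheb t (n + 1)) ^ 2 := by
        rw [hρ]; field_simp; linear_combination hinv
      have h2 : (ρ - μ) ^ 2 ≤ (1 / cheb t (n + 1)) ^ 2 := by
        have hρμ : ρ ≤ μ := by
          by_contra! h
          have : 0 < (1 / cheb t (n + 1)) ^ 2 := by positivity
          nlinarith
        rw [← hρq]
        nlinarith [mul_nonneg (sub_nonneg.2 hρμ) (sub_nonneg.2 hμt)]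
      have h3 : |ρ - μ| ≤ 1 / cheb t (n + 1) := by
        have := sq_le_sq.1 h2
        rwa [abs_of_pos (show 0 < 1 / cheb t (n + 1) by positivity)] at this
      exact h3.trans (one_div_le_one_div_of_le (by positivity) hge)
    rw [tendsto_iff_norm_sub_tendsto_zero]
    exact squeeze_zero (fun _ => norm_nonneg _) hb tendsto_one_div_add_atTop_nhds_zero_nat
  set R : Matrix (Fin 2) (Fin 2) ℝ := X - μ • 1 with hR
  have hRdet : R.det = 0 := by
    rw [det_fin_two] at hX
    rw [trace_fin_two] at htX
    have e : R.det = (X 0 0 - μ) * (X 1 1 - μ) - X 0 1 * X 1 0 := by simp [hR, det_fin_two]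
    rw [e]
    linear_combination hX + hquad + μ * htX
  have hR0 : R ≠ 0 := fun h => hns μ (sub_eq_zero.1 h)
  obtain ⟨u, r, hu, hr, hur⟩ : ∃ u r : Fin 2 → ℝ, u ≠ 0 ∧ r ≠ 0 ∧ ∀ v, R *ᵥ v = wedge r v • u := by
    obtain ⟨z, hz⟩ : ∃ z, R *ᵥ z ≠ 0 := by
      by_contra! h
      exact hR0 (Matrix.ext_of_mulVec_single fun i => by rw [h, zero_mulVec])
    obtain ⟨y, hy⟩ := exists_wedge_eq_one hz
    have hpar : ∀ v, wedge (R *ᵥ z) (R *ᵥ v) = 0 := fun v => by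
      rw [wedge_mulVec, hRdet, zero_mul]
    have h1 : ∀ v, R *ᵥ v = wedge (R *ᵥ v) y • (R *ᵥ z) := fun v => by
      have := wedge_cramer (R *ᵥ z) y (R *ᵥ v)
      rwa [hy, hpar, one_smul, zero_smul, add_zero] at this
    refine ⟨R *ᵥ z, ![wedge (R *ᵥ ![0, 1]) y, -wedge (R *ᵥ ![1, 0]) y], hz, fun h0 => ?_,
      fun v => ?_⟩
    · have e0 := congrFun h0 0
      have e1 := congrFun h0 1
      have : wedge (R *ᵥ z) y = z 0 * wedge (R *ᵥ ![1, 0]) y + z 1 * wedge (R *ᵥ ![0, 1]) y := by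
        simp [wedge]; ring
      simp only [cons_val_zero, cons_val_one, Pi.zero_apply, neg_eq_zero] at e0 e1
      rw [hy, e0, e1] at this
      simp at this
    · conv_lhs => rw [h1]
      congr 1
      simp [wedge]; ring
  have hcomm : ∀ v, R *ᵥ (X *ᵥ v) = X *ᵥ (R *ᵥ v) := fun v => by
    rw [mulVec_mulVec, mulVec_mulVec, hR, sub_mul, mul_sub]; simp
  refine ⟨fun n => (cheb t (n + 1))⁻¹, u, r, hu, hr, ?_, ?_, fun v => ?_⟩
  · obtain ⟨z, hz⟩ := exists_wedge_eq_one hr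
    have := hcomm z
    rw [hur, hur, hz, one_smul] at this
    rw [← this, wedge_smul, wedge_self, mul_zero]
  · have := hcomm r
    rw [hur, hur, wedge_self, zero_smul, mulVec_zero] at this
    exact (smul_eq_zero.1 this).resolve_right hu
  · have e : ∀ n, (cheb t (n + 1))⁻¹ • (X ^ (n + 1) *ᵥ v) =
        X *ᵥ v - (cheb t n / cheb t (n + 1)) • v := by
      intro n
      obtain ⟨h0, h1⟩ := cheb_step ht n
      have hpos : cheb t (n + 1) ≠ 0 := by linarith
      rw [pow_succ_eq_cheb hX, sub_mulVec, smul_mulVec, smul_mulVec, one_mulVec, smul_sub,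
        smul_smul, smul_smul, ← htX, inv_mul_cancel₀ hpos, one_smul, inv_mul_eq_div]
    simp only [e]
    rw [← hur, hR, sub_mulVec, smul_mulVec, one_mulVec]
    exact tendsto_const_nhds.sub (hlim.smul_const v)

end Dynamics

section Construction

open Topology

variable {G : Type*} [Group G] {ρ : G →* Matrix (Fin 2) (Fin 2) ℝ}

lemma wedge_map (hdet : ∀ g, (ρ g).det = 1) (g : G) (u v : Fin 2 → ℝ) :
    wedge (ρ g *ᵥ u) v = wedge u (ρ g⁻¹ *ᵥ v) := by
  have := wedge_mulVec (ρ g⁻¹) (ρ g *ᵥ u) v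
  rw [hdet, one_mul, mulVec_mulVec, ← map_mul, inv_mul_cancel, map_one, one_mulVec] at this
  exact this.symm

lemma wedge_pow_pow_ne_zero (hdet : ∀ g, (ρ g).det = 1) {x : G} (ht : 2 ≤ (ρ x).trace)
    {w : Fin 2 → ℝ} (hw : wedge w (ρ x *ᵥ w) ≠ 0) {m n : ℕ} (hmn : m ≠ n) :
    wedge (ρ (x ^ m) *ᵥ w) (ρ (x ^ n) *ᵥ w) ≠ 0 := by
  wlog h : m < n generalizing m n
  · rw [wedge_comm, neg_ne_zero]
    exact this hmn.symm (by omega)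
  · obtain ⟨k, rfl⟩ := Nat.exists_eq_add_of_lt h
    rw [wedge_map hdet, mulVec_mulVec, ← map_mul, show (x ^ m)⁻¹ * x ^ (m + k + 1) = x ^ (k + 1) by
      group, map_pow]
    exact wedge_pow_ne_zero (hdet x) ht hw k

/-- If `y` and `y⁻¹` do not map a fixed line of `x` to a fixed line of `x`, then the semigroup
generated by `x` and `y` contains arbitrarily large Schottky families. -/
lemma exists_schottky (hdet : ∀ g, (ρ g).det = 1) {x y : G} (ht : 2 ≤ (ρ x).trace)
    (hns : ∀ c : ℝ, ρ x ≠ c • 1)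
    (hy : ∀ u ≠ 0, wedge u (ρ x *ᵥ u) = 0 → wedge (ρ y *ᵥ u) (ρ x *ᵥ ρ y *ᵥ u) ≠ 0)
    (hy' : ∀ u ≠ 0, wedge u (ρ x *ᵥ u) = 0 → wedge (ρ y⁻¹ *ᵥ u) (ρ x *ᵥ ρ y⁻¹ *ᵥ u) ≠ 0)
    (N : ℕ) : ∃ (n : ℕ) (s : Fin N → G) (e f e' f' : Fin N → Fin 2 → ℝ),
      Schottky ρ s e f e' f' ∧ Function.Injective s ∧
      ∀ i : Fin N, s i = x ^ (i : ℕ) * y * x ^ (n + 1) * (y * x ^ (N - i)) := by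
  obtain ⟨c, u, r, hu, hr, hxu, hxr, hlim⟩ := exists_rank_one_limit (hdet x) ht hns
  let U : Fin N → Fin 2 → ℝ := fun i => ρ (x ^ (i : ℕ) * y) *ᵥ u
  let V : Fin N → Fin 2 → ℝ := fun i => ρ (y * x ^ (N - i))⁻¹ *ᵥ r
  let S : ℕ → Fin N → G := fun n i => x ^ (i : ℕ) * y * x ^ (n + 1) * (y * x ^ (N - i))
  have hS : ∀ i v, Tendsto (fun n => c n • (ρ (S n i) *ᵥ v)) atTop (𝓝 (wedge (V i) v • U i)) := by
    intro i v
    have h1 := hlim (ρ (y * x ^ (N - i)) *ᵥ v)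
    have hc : Continuous fun w : Fin 2 → ℝ => ρ (x ^ (i : ℕ) * y) *ᵥ w := by fun_prop
    have h2 := (hc.tendsto _).comp h1
    have h3 : wedge (V i) v = wedge r (ρ (y * x ^ (N - i)) *ᵥ v) := by
      simp only [V]
      rw [wedge_map hdet, inv_inv]
    rw [h3, ← mulVec_smul]
    convert h2 using 2 with n
    simp only [S, Function.comp, mulVec_smul, map_mul _ (_ * _ * x ^ (n + 1)),
      map_mul _ (x ^ (i : ℕ) * y), mulVec_mulVec, map_pow, Matrix.mul_assoc]
  have hU0 : ∀ i, U i ≠ 0 := fun i => mulVec_ne_zero (hdet _) hu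
  have hV0 : ∀ i, V i ≠ 0 := fun i => mulVec_ne_zero (hdet _) hr
  have hUU : ∀ i j, i ≠ j → wedge (U i) (U j) ≠ 0 := by
    intro i j hij
    simp only [U, map_mul, ← mulVec_mulVec]
    exact wedge_pow_pow_ne_zero hdet ht (hy u hu hxu) (by simpa [Fin.val_inj] using hij)
  have hVV : ∀ i j, i ≠ j → wedge (V i) (V j) ≠ 0 := by
    intro i j hij
    have hij' : N - (j : ℕ) ≠ N - i := fun h => hij (Fin.ext (by omega))
    have h := wedge_pow_pow_ne_zero hdet ht (hy' r hr hxr) hij'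
    have hcomm : (x ^ (N - j))⁻¹ * x ^ (N - i) = x ^ (N - i) * (x ^ (N - j))⁻¹ :=
      ((Commute.refl x).pow_pow _ _).inv_left.eq
    have hV : ∀ k : Fin N, V k = ρ (x ^ (N - k))⁻¹ *ᵥ ρ y⁻¹ *ᵥ r := by
      simp [V, map_mul, -mulVec_fin_two]
    rw [wedge_map hdet, mulVec_mulVec, ← map_mul, hcomm, map_mul, ← mulVec_mulVec] at h
    rwa [hV, hV, wedge_map hdet, inv_inv]
  choose z hz using fun i => exists_wedge_eq_one (hU0 i)
  choose z' hz' using fun i => exists_wedge_eq_one (hV0 i)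
  obtain ⟨δ, ⟨hδU, hδV⟩, hδ⟩ : ∃ δ : ℝ, ((∀ i j, i ≠ j → ∀ v,
      v ∈ cone (U i + δ • z i) (U i + (-δ) • z i) →
      v ∉ cone (U j + δ • z j) (U j + (-δ) • z j)) ∧ ∀ i j, i ≠ j → ∀ v,
      v ∈ cone (V i + δ • z' i) (V i + (-δ) • z' i) →
      v ∉ cone (V j + δ • z' j) (V j + (-δ) • z' j)) ∧ 0 < δ := by
    have : ∀ᶠ δ : ℝ in 𝓝[>] 0, 0 < δ := self_mem_nhdsWithin
    refine (((eventually_all.2 fun i => eventually_all.2 fun j => ?_).and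
      (eventually_all.2 fun i => eventually_all.2 fun j => ?_)).and this).exists
    · rw [eventually_imp_distrib_left]
      exact fun hij => eventually_disjoint_cone (hUU i j hij)
    · rw [eventually_imp_distrib_left]
      exact fun hij => eventually_disjoint_cone (hVV i j hij)
  have hmaps := eventually_all.2 fun i => eventually_maps_cone (hz i) (hz' i) hδ (hS i)
  have hinj : ∀ᶠ n in atTop, ∀ i j, i ≠ j → S n i ≠ S n j := by
    refine eventually_all.2 fun i => eventually_all.2 fun j => ?_
    rw [eventually_imp_distrib_left]
    intro hij
    have hc : Continuous (wedge (U i)) := by unfold wedge; fun_prop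
    have h1 := (hc.tendsto _).comp (hS i (z' j))
    have h2 := (hc.tendsto _).comp (hS j (z' j))
    rw [wedge_smul, wedge_self, mul_zero] at h1
    rw [wedge_smul, hz', one_mul] at h2
    filter_upwards [(h2.sub h1).eventually_ne (by simpa using hUU i j hij)] with n hn h
    simp [Function.comp, h] at hn
  obtain ⟨n, hn, hn'⟩ := (hmaps.and hinj).exists
  have hwedge : ∀ w w' : Fin 2 → ℝ, wedge w w' = 1 → wedge (w + δ • w') (w + (-δ) • w') ≠ 0 := by
    intro w w' hw
    simp only [wedge_add, add_wedge, wedge_smul, smul_wedge, wedge_self, wedge_comm w' w, hw]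
    intro h
    linarith
  refine ⟨n, S n, fun i => U i + δ • z i, fun i => U i + (-δ) • z i, fun i => V i + δ • z' i,
    fun i => V i + (-δ) • z' i, ⟨hdet, fun i => hwedge _ _ (hz i), fun i => ⟨fun h => ?_, fun h => ?_⟩,
    fun i j v hi hj => ?_, fun i j v hi hj => ?_, hn⟩, fun i j h => ?_, fun i => rfl⟩
  · exact hwedge _ _ (hz' i) (by rw [h]; simp [wedge])
  · exact hwedge _ _ (hz' i) (by rw [h]; simp [wedge])
  · by_contra hij
    exact hδU i j hij v hi hj
  · by_contra hij
    exact hδV i j hij v hi hj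
  · by_contra hij
    exact hn' i j hij h

end Construction

section Sanov

open ModularGroup UpperHalfPlane

open scoped MatrixGroups

/-- The parabolic generators of Sanov's subgroup of `SL(2, ℤ)`. -/
def sanovGen : Fin 2 → SL(2, ℤ) := ![T ^ 2, S⁻¹ * T ^ 2 * S]

lemma abs_re_S_smul_lt {z : ℍ} (hz : 1 ≤ |z.re|) : |(S • z).re| < 1 := by
  have h : (S • z).re = -z.re / (z.re ^ 2 + z.im ^ 2) := by
    rw [modular_S_smul]
    simp [Complex.inv_re, Complex.normSq_apply, sq, neg_div]
  have him := z.im_pos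
  rw [h, abs_div, abs_neg, abs_of_pos (a := _ + _) (by positivity), div_lt_one (by positivity),
    ← sq_abs z.re]
  nlinarith

lemma re_T_sq_smul (z : ℍ) : ((T ^ 2 : SL(2, ℤ)) • z).re = z.re + 2 := by
  simpa using! re_T_zpow_smul z 2

lemma re_T_sq_inv_smul (z : ℍ) : ((T ^ 2 : SL(2, ℤ))⁻¹ • z).re = z.re - 2 := by
  have := re_T_sq_smul ((T ^ 2 : SL(2, ℤ))⁻¹ • z)
  rw [smul_inv_smul] at this
  linarith

lemma injective_lift_sanovGen : Function.Injective (FreeGroup.lift sanovGen) := by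
  let c : Fin 2 → SL(2, ℤ) := ![1, S]
  have hc : ∀ i, sanovGen i = (c i)⁻¹ * T ^ 2 * c i := by
    intro i; fin_cases i <;> simp [sanovGen, c]
  have hdisj : ∀ i j, i ≠ j → ∀ z : ℍ, 1 ≤ |(c i • z).re| → ¬ 1 ≤ |(c j • z).re| := by
    intro i j hij z h h'
    fin_cases i <;> fin_cases j
    · exact hij rfl
    · exact (abs_re_S_smul_lt (by simpa [c] using h)).not_ge h'
    · exact (abs_re_S_smul_lt (by simpa [c] using h')).not_ge h
    · exact hij rfl
  refine FreeGroup.injective_lift_of_ping_pong sanovGen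
    (fun i => {z : ℍ | 1 ≤ (c i • z).re}) (fun i => {z : ℍ | (c i • z).re ≤ -1})
    (fun i => ⟨(c i)⁻¹ • (T ^ 2 : SL(2, ℤ)) • UpperHalfPlane.I, ?_⟩)
    (fun i j hij => ?_) (fun i j hij => ?_) (fun i j => ?_) (fun i => ?_) (fun i => ?_)
  · rw [Set.mem_ofPred_eq, smul_inv_smul, re_T_sq_smul]
    simp
  · exact Set.disjoint_left.2 fun z hi hj => hdisj i j hij z (le_abs.2 (.inl hi))
      (le_abs.2 (.inl hj))
  · exact Set.disjoint_left.2 fun z hi hj => hdisj i j hij z (le_abs.2 (.inr (le_neg.1 hi)))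
      (le_abs.2 (.inr (le_neg.1 hj)))
  · refine Set.disjoint_left.2 fun z hi hj => ?_
    obtain rfl | hij := eq_or_ne i j
    · rw [Set.mem_ofPred_eq] at hi hj
      linarith
    · exact hdisj i j hij z (le_abs.2 (.inl hi)) (le_abs.2 (.inr (le_neg.1 hj)))
  · rintro _ ⟨z, hz, rfl⟩
    rw [Set.mem_compl_iff, Set.mem_ofPred_eq, not_le] at hz
    simp only [Set.mem_ofPred_eq, hc, mul_smul, smul_inv_smul, re_T_sq_smul]
    linarith
  · rintro _ ⟨z, hz, rfl⟩
    rw [Set.mem_compl_iff, Set.mem_ofPred_eq, not_le] at hz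
    simp only [Set.mem_ofPred_eq, Pi.inv_apply, hc, _root_.mul_inv_rev, mul_smul, smul_inv_smul,
      inv_inv, re_T_sq_inv_smul]
    linarith

end Sanov

section Arithmetic

lemma eq_two_or_eq_neg_two_of_sq_sub_four {t m : ℤ} (h : t ^ 2 - 4 = m ^ 2) :
    (t = 2 ∨ t = -2) ∧ m = 0 := by
  have h1 : m ^ 2 < |t| ^ 2 := by rw [sq_abs]; linarith
  have h2 : |m| < |t| := abs_lt_of_sq_lt_sq' (by simpa using h1) (abs_nonneg t) |> abs_lt.2
  have h3 : |m| = 0 := by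
    by_contra hm
    have := abs_nonneg m
    have h4 : |t| ^ 2 - 4 = |m| ^ 2 := by simpa using h
    obtain h5 | h5 : |t| = |m| + 1 ∨ |m| + 2 ≤ |t| := by omega
    · rw [h5] at h4
      have : 2 * |m| = 3 := by linarith
      omega
    · nlinarith [show 1 ≤ |m| by omega]
  have hm : m = 0 := by simpa using h3
  refine ⟨?_, hm⟩
  have : (t - 2) * (t + 2) = 0 := by rw [hm] at h; linarith
  obtain h | h := mul_eq_zero.1 this
  · left; linarith
  · right; linarith

/-- Two integral binary quadratic forms with a common root are proportional if the discriminant of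
one of them is not a square. -/
lemma proportional_of_common_root {A B C A' B' C' : ℤ} (hsq : ¬ IsSquare (B ^ 2 - 4 * A * C))
    {u v : ℝ} (huv : u ≠ 0 ∨ v ≠ 0) (h : A * u ^ 2 + B * (u * v) + C * v ^ 2 = 0)
    (h' : A' * u ^ 2 + B' * (u * v) + C' * v ^ 2 = 0) :
    A ≠ 0 ∧ A' * B = A * B' ∧ A' * C = A * C' := by
  have hA : A ≠ 0 := by
    rintro rfl
    exact hsq ⟨B, by ring⟩
  have hv : v ≠ 0 := by
    rintro rfl
    simp_all
  have hlin : ((A' * B - A * B' : ℤ) : ℝ) * u + ((A' * C - A * C' : ℤ) : ℝ) * v = 0 := by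
    refine (mul_eq_zero.1 (?_ : v * _ = 0)).resolve_left hv
    push_cast
    linear_combination A' * h - A * h'
  set K := A' * B - A * B'
  set L := A' * C - A * C'
  have hK : K = 0 := by
    by_contra hK
    have hd : ((K ^ 2 * (B ^ 2 - 4 * A * C) : ℤ) : ℝ) = ((-2 * A * L + B * K : ℤ) : ℝ) ^ 2 := by
      have : v ^ 2 ≠ 0 := by positivity
      apply mul_left_cancel₀ this
      push_cast
      linear_combination (-4 * A * K ^ 2 : ℝ) * h +
        (4 * A ^ 2 * (K * u - L * v) + 4 * A * B * K * v) * hlin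
    have hd' : (K : ℤ) ^ 2 * (B ^ 2 - 4 * A * C) = (-2 * A * L + B * K) ^ 2 := by
      exact_mod_cast hd
    obtain ⟨w, hw⟩ : K ∣ -2 * A * L + B * K :=
      (Int.pow_dvd_pow_iff two_ne_zero).1 ⟨_, hd'.symm⟩
    rw [hw, mul_pow] at hd'
    exact hsq ⟨w, by rw [mul_left_cancel₀ (pow_ne_zero 2 hK) hd', sq]⟩
  refine ⟨hA, by linarith, ?_⟩
  rw [hK] at hlin
  have : L = 0 := by simpa [hv] using hlin
  linarith

variable {a b c d p q r s : ℤ} {u v : ℝ}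

lemma commute_of_common_line_of_hyperbolic (hX : a * d - b * c = 1) (hY : p * s - q * r = 1)
    (ht : 3 ≤ a + d) (hT : p + s ≠ 0) (huv : u ≠ 0 ∨ v ≠ 0)
    (h : c * u ^ 2 + (d - a) * (u * v) - b * v ^ 2 = 0)
    (h' : c * (p * u + q * v) ^ 2 + (d - a) * ((p * u + q * v) * (r * u + s * v))
      - b * (r * u + s * v) ^ 2 = 0) :
    b * r = c * q ∧ q * (a - d) + b * (s - p) = 0 ∧ r * (d - a) - c * (s - p) = 0 := by
  obtain ⟨A, hA⟩ : ∃ A, A = c * p ^ 2 + (d - a) * (p * r) - b * r ^ 2 := ⟨_, rfl⟩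
  obtain ⟨B, hB⟩ : ∃ B, B = 2 * c * (p * q) + (d - a) * (p * s + q * r) - 2 * b * (r * s) :=
    ⟨_, rfl⟩
  obtain ⟨C, hC⟩ : ∃ C, C = c * q ^ 2 + (d - a) * (q * s) - b * s ^ 2 := ⟨_, rfl⟩
  have hsq : ¬ IsSquare ((d - a) ^ 2 - 4 * c * (-b)) := by
    rintro ⟨m, hm⟩
    have := (eq_two_or_eq_neg_two_of_sq_sub_four (t := a + d) (m := m)
      (by linear_combination hm + 4 * hX)).1
    omega
  obtain ⟨hc, h1, h2⟩ := proportional_of_common_root (A' := A) (B' := B) (C' := C) hsq huv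
    (by push_cast; linear_combination h) (by rw [hA, hB, hC]; push_cast; linear_combination h')
  have hdisc : B ^ 2 - 4 * A * C = (d - a) ^ 2 + 4 * b * c := by
    rw [hA, hB, hC]
    linear_combination ((d - a) ^ 2 + 4 * b * c) * (p * s - q * r + 1) * hY
  have hdisc0 : (d - a) ^ 2 + 4 * b * c ≠ 0 := fun h0 => hsq ⟨0, by linarith⟩
  have hAc : A ^ 2 = c ^ 2 := by
    apply mul_right_cancel₀ hdisc0
    linear_combination (A * (d - a) + c * B) * h1 - 4 * A * c * h2 + c ^ 2 * hdisc
  obtain hAc | hAc := sq_eq_sq_iff_eq_or_eq_neg.1 hAc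
  · rw [hAc] at h1 h2
    have hB' := mul_left_cancel₀ hc h1
    have hC' := mul_left_cancel₀ hc h2
    refine ⟨?_, ?_, ?_⟩ <;> refine sub_eq_zero.1 ((mul_eq_zero.1 ?_).resolve_left two_ne_zero)
    · linear_combination p * (hB' + hB) + 2 * q * (hAc - hA) +
        (p * (a + d) - 2 * (a * p + b * r)) * hY
    · linear_combination -q * (hB' + hB) + 2 * p * (hC' + hC) +
        (q * (a + d) - 2 * (a * q + b * s)) * hY
    · linear_combination r * (hB' + hB) + 2 * s * (hAc - hA) +
        (r * (a + d) - 2 * (c * p + d * r)) * hY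
  · rw [hAc] at h1
    have hB' : -(d - a) = B := mul_left_cancel₀ hc (by linarith)
    have : 2 * c * (p + s) = 0 := by
      linear_combination r * (hB' + hB) + 2 * s * (hAc - hA) +
        (r * (a + d) - 2 * (c * p + d * r)) * hY
    simp_all

lemma commute_of_common_line_of_parabolic (hX : a * d - b * c = 1) (hY : p * s - q * r = 1)
    (ht : a + d = 2) (huv : u ≠ 0 ∨ v ≠ 0)
    (h : c * u ^ 2 + (d - a) * (u * v) - b * v ^ 2 = 0)
    (h' : c * (p * u + q * v) ^ 2 + (d - a) * ((p * u + q * v) * (r * u + s * v))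
      - b * (r * u + s * v) ^ 2 = 0) :
    b * r = c * q ∧ q * (a - d) + b * (s - p) = 0 ∧ r * (d - a) - c * (s - p) = 0 := by
  obtain ⟨α, rfl⟩ : ∃ α, a = α + 1 := ⟨a - 1, by ring⟩
  obtain rfl : d = 1 - α := by linarith
  have hα : α ^ 2 = -(b * c) := by linear_combination -hX
  have hα' : (α : ℝ) ^ 2 = -(b * c) := by exact_mod_cast hα
  push_cast at h h'
  have key : ∀ {x y : ℝ}, c * x ^ 2 + (1 - α - (α + 1)) * (x * y) - b * y ^ 2 = 0 →
      c * x = α * y ∧ α * x = -(b * y) := by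
    intro x y h
    constructor
    · refine sub_eq_zero.1 (pow_eq_zero_iff two_ne_zero |>.1 ?_)
      linear_combination c * h + y ^ 2 * hα'
    · refine sub_eq_zero.1 (pow_eq_zero_iff two_ne_zero |>.1 ?_)
      linear_combination -b * h + x ^ 2 * hα'
  obtain ⟨h1, h2⟩ := key h
  obtain ⟨h3, h4⟩ := key h'
  obtain rfl | hc := eq_or_ne c 0
  · obtain rfl : α = 0 := by simpa using hα
    obtain rfl | hb := eq_or_ne b 0
    · simp
    · have hv : v = 0 := by simpa [hb] using h2
      subst hv
      have hr : r = 0 := by simp_all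
      subst hr
      have hps : p * s = 1 := by linarith
      obtain ⟨rfl, rfl⟩ | ⟨rfl, rfl⟩ := Int.mul_eq_one_iff_eq_one_or_neg_one.1 hps <;> simp
  · have hv : v ≠ 0 := by
      rintro rfl
      simp_all
    have hk : r * α ^ 2 + (s - p) * (α * c) - q * c ^ 2 = 0 := by
      have : ((r * α ^ 2 + (s - p) * (α * c) - q * c ^ 2 : ℤ) : ℝ) = 0 := by
        refine (mul_eq_zero.1 (?_ : v * _ = 0)).resolve_left hv
        push_cast
        linear_combination -c * h3 + (c * p - α * r) * h1
      exact_mod_cast this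
    have hsq : c ^ 2 * ((p + s) ^ 2 - 4) = (2 * r * α + (s - p) * c) ^ 2 := by
      linear_combination -4 * r * hk + 4 * c ^ 2 * hY
    obtain ⟨m, hm⟩ : c ∣ 2 * r * α + (s - p) * c :=
      (Int.pow_dvd_pow_iff two_ne_zero).1 ⟨_, hsq.symm⟩
    rw [hm, mul_pow] at hsq
    obtain rfl := (eq_two_or_eq_neg_two_of_sq_sub_four
      (mul_left_cancel₀ (pow_ne_zero 2 hc) hsq)).2
    refine ⟨?_, ?_, ?_⟩
    · apply mul_left_cancel₀ hc
      linear_combination hk - α * hm + r * hα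
    · apply mul_left_cancel₀ (pow_ne_zero 2 hc)
      linear_combination -2 * α * hk + α ^ 2 * hm + c * (s - p) * hα
    · linear_combination -hm

end Arithmetic

section Faithful

open ModularGroup

open scoped MatrixGroups

/-- The faithful representation of the free group of rank two by Sanov's matrices. -/
def sanovRep : FreeGroup (Fin 2) →* Matrix (Fin 2) (Fin 2) ℝ :=
  (Int.castRingHom ℝ).mapMatrix.toMonoidHom.comp
    (Matrix.SpecialLinearGroup.coeMonoidHom.comp (FreeGroup.lift sanovGen))

lemma sanovRep_apply (g : FreeGroup (Fin 2)) (i j : Fin 2) :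
    sanovRep g i j = ((FreeGroup.lift sanovGen g i j : ℤ) : ℝ) := rfl

lemma injective_sanovRep : Function.Injective sanovRep := by
  intro g h hgh
  refine injective_lift_sanovGen (Matrix.SpecialLinearGroup.ext _ _ fun i j => ?_)
  have := congr_fun₂ hgh i j
  rwa [sanovRep_apply, sanovRep_apply, Int.cast_inj] at this

lemma det_sanovRep (g : FreeGroup (Fin 2)) : (sanovRep g).det = 1 := by
  have : sanovRep g = (Matrix.SpecialLinearGroup.map (Int.castRingHom ℝ) (FreeGroup.lift sanovGen g)).1 :=
    rfl
  rw [this]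
  exact Matrix.SpecialLinearGroup.det_coe _

lemma four_le_trace_sanovRep_sq (g : FreeGroup (Fin 2)) : 4 ≤ (sanovRep g).trace ^ 2 := by
  have hmap : (Matrix.SpecialLinearGroup.map (Int.castRingHom (ZMod 2))).comp (FreeGroup.lift sanovGen)
      = 1 := by
    refine FreeGroup.ext_hom _ _ fun i => ?_
    fin_cases i <;> ext i j <;> fin_cases i <;> fin_cases j <;>
      simp [sanovGen, coe_T, coe_S, sq, Matrix.SpecialLinearGroup.coe_inv, adjugate_fin_two] <;> decide
  have hmod : ∀ i j, ((FreeGroup.lift sanovGen g i j : ℤ) : ZMod 2) =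
      (1 : Matrix (Fin 2) (Fin 2) (ZMod 2)) i j := fun i j =>
    congr_fun₂ (congr_arg Subtype.val (DFunLike.congr_fun hmap g)) i j
  have hdet := (FreeGroup.lift sanovGen g).det_coe
  have h00 := hmod 0 0
  have h01 := hmod 0 1
  have h10 := hmod 1 0
  have h11 := hmod 1 1
  rw [trace_fin_two, sanovRep_apply, sanovRep_apply]
  norm_cast
  rw [det_fin_two] at hdet
  generalize FreeGroup.lift sanovGen g 0 0 = a at *
  generalize FreeGroup.lift sanovGen g 0 1 = b at *
  generalize FreeGroup.lift sanovGen g 1 0 = c at *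
  generalize FreeGroup.lift sanovGen g 1 1 = d at *
  obtain ⟨b, rfl⟩ := (ZMod.intCast_zmod_eq_zero_iff_dvd b 2).1 (by simpa using h01)
  obtain ⟨c, rfl⟩ := (ZMod.intCast_zmod_eq_zero_iff_dvd c 2).1 (by simpa using h10)
  obtain ⟨a, rfl⟩ : Odd a := ZMod.intCast_eq_one_iff_odd.1 (by simpa using h00)
  obtain ⟨d, rfl⟩ : Odd d := ZMod.intCast_eq_one_iff_odd.1 (by simpa using h11)
  have h : a + d + 1 ≠ 0 := by
    intro h
    obtain rfl : d = -a - 1 := by linarith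
    have : 2 * (2 * (a ^ 2 + a + b * c) + 1) = 0 := by push_cast at hdet; linarith
    omega
  have : 1 ≤ (a + d + 1) ^ 2 := by
    have := sq_nonneg (a + d + 1)
    have := pow_ne_zero 2 h
    omega
  linarith

lemma trace_sanovRep_ne_zero (g : FreeGroup (Fin 2)) : (sanovRep g).trace ≠ 0 := by
  intro h
  have := four_le_trace_sanovRep_sq g
  rw [h] at this
  norm_num at this

lemma wedge_sanovRep_ne_zero {x y : FreeGroup (Fin 2)} (hxy : x * y ≠ y * x)
    (ht : 2 ≤ (sanovRep x).trace) {u : Fin 2 → ℝ} (hu : u ≠ 0)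
    (h : wedge u (sanovRep x *ᵥ u) = 0) :
    wedge (sanovRep y *ᵥ u) (sanovRep x *ᵥ sanovRep y *ᵥ u) ≠ 0 := by
  intro h'
  apply hxy
  apply injective_lift_sanovGen
  have hT := trace_sanovRep_ne_zero y
  have hX := (FreeGroup.lift sanovGen x).det_coe
  have hY := (FreeGroup.lift sanovGen y).det_coe
  have hu' : u 0 ≠ 0 ∨ u 1 ≠ 0 := by
    by_contra! h0
    exact hu (by ext i; fin_cases i <;> simp [h0])
  simp only [wedge, mulVec_fin_two, sanovRep_apply, trace_fin_two] at h h' ht hT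
  norm_cast at ht hT
  rw [det_fin_two] at hX hY
  have hcomm := (show _ ∨ _ by omega : (FreeGroup.lift sanovGen x 0 0 +
    FreeGroup.lift sanovGen x 1 1 = 2) ∨ (3 ≤ FreeGroup.lift sanovGen x 0 0 +
    FreeGroup.lift sanovGen x 1 1)).elim
    (fun ht => commute_of_common_line_of_parabolic hX hY ht hu' (by simp at h; linear_combination h)
      (by simp at h'; linear_combination h'))
    (fun ht => commute_of_common_line_of_hyperbolic hX hY ht hT hu'
      (by simp at h; linear_combination h) (by simp at h'; linear_combination h'))
  obtain ⟨h1, h2, h3⟩ := hcomm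
  refine Matrix.SpecialLinearGroup.ext _ _ fun i j => ?_
  rw [map_mul, map_mul, Matrix.SpecialLinearGroup.coe_mul, Matrix.SpecialLinearGroup.coe_mul]
  fin_cases i <;> fin_cases j <;> simp [Matrix.mul_apply] <;> linarith

lemma sanovRep_sq (x : FreeGroup (Fin 2)) :
    sanovRep (x ^ 2) = (sanovRep x).trace • sanovRep x - 1 := by
  have := det_sanovRep x
  rw [det_fin_two] at this
  rw [sq, map_mul]
  ext i j
  fin_cases i <;> fin_cases j <;> simp [Matrix.mul_apply, trace_fin_two] <;> linarith

lemma trace_sanovRep_sq_mul (x y : FreeGroup (Fin 2)) : (sanovRep (x ^ 2 * y)).trace =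
    (sanovRep x).trace * (sanovRep (x * y)).trace - (sanovRep y).trace := by
  rw [map_mul, sanovRep_sq, sub_mul, one_mul, smul_mul_assoc, ← map_mul, trace_sub, trace_smul,
    smul_eq_mul]

lemma sq_mul_ne_mul_sq {x y : FreeGroup (Fin 2)} (hxy : x * y ≠ y * x) :
    x ^ 2 * y ≠ y * x ^ 2 := by
  intro h
  apply hxy
  apply injective_sanovRep
  have := congr_arg sanovRep h
  rw [map_mul, map_mul, sanovRep_sq, sub_mul, mul_sub, one_mul, mul_one, sub_left_inj, smul_mul_assoc,
    mul_smul_comm] at this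
  rw [map_mul, map_mul]
  exact smul_right_injective _ (trace_sanovRep_ne_zero x) this

lemma two_le_trace_sq (x : FreeGroup (Fin 2)) : 2 ≤ (sanovRep (x ^ 2)).trace := by
  have := four_le_trace_sanovRep_sq x
  have := trace_sanovRep_sq_mul x 1
  simp only [mul_one, map_one, trace_one, Fintype.card_fin] at this
  push_cast at this
  linarith

end Faithful

section Parabolic

lemma trace_sanovRep_inv (x : FreeGroup (Fin 2)) :
    (sanovRep x⁻¹).trace = (sanovRep x).trace := by
  have := trace_sanovRep_sq_mul x x⁻¹
  rw [sq, mul_inv_cancel_right, mul_inv_cancel, map_one, trace_one, Fintype.card_fin] at this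
  push_cast at this
  linarith

lemma trace_sanovRep_pow {x : FreeGroup (Fin 2)} {ε : ℝ} (hε : ε ^ 2 = 1)
    (hx : (sanovRep x).trace = 2 * ε) (n : ℕ) : (sanovRep (x ^ n)).trace = 2 * ε ^ n := by
  induction n using Nat.twoStepInduction with
  | zero => simp
  | one => simpa using hx
  | more n h0 h1 =>
    rw [add_comm, pow_add, trace_sanovRep_sq_mul, ← pow_succ', h0, h1, hx]
    linear_combination 2 * ε ^ n * hε

lemma trace_sanovRep_zpow_sq {x : FreeGroup (Fin 2)} (hx : (sanovRep x).trace ^ 2 = 4) (k : ℤ) :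
    (sanovRep (x ^ k)).trace ^ 2 = 4 := by
  have h : ∀ n : ℕ, (sanovRep (x ^ n)).trace ^ 2 = 4 := by
    intro n
    have hε : ((sanovRep x).trace / 2) ^ 2 = 1 := by linarith
    rw [trace_sanovRep_pow hε (by ring), mul_pow, ← pow_mul, mul_comm n, pow_mul, hε]
    norm_num
  obtain ⟨n, rfl | rfl⟩ := k.eq_nat_or_neg
  · rw [zpow_natCast, h]
  · rw [_root_.zpow_neg, zpow_natCast, trace_sanovRep_inv, h]

/-- All conjugates of powers of `a`, `b` and `ab` are mapped to parabolic matrices. -/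
lemma trace_sanovRep_sq_of_conj {g w : FreeGroup (Fin 2)} {k : ℤ}
    (h : g * w * g⁻¹ = FreeGroup.of 0 ^ k ∨ g * w * g⁻¹ = FreeGroup.of 1 ^ k ∨
      g * w * g⁻¹ = (FreeGroup.of 0 * FreeGroup.of 1) ^ k) : (sanovRep w).trace ^ 2 = 4 := by
  have hconj : (sanovRep (g * w * g⁻¹)).trace = (sanovRep w).trace := by
    rw [map_mul, trace_mul_comm, ← map_mul]
    congr 2
    group
  rw [← hconj]
  obtain h | h | h := h <;> rw [h] <;> apply trace_sanovRep_zpow_sq <;>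
    simp [trace_fin_two, sanovRep_apply, sanovGen, ModularGroup.coe_T, ModularGroup.coe_S, sq,
      Matrix.SpecialLinearGroup.coe_inv, adjugate_fin_two, Matrix.mul_apply] <;> norm_num

end Parabolic

section Decay

lemma tsum_iterate_avg_ne_top (ν : Measure F₂) [IsProbabilityMeasure ν] {x y : F₂}
    (hx : ν {x} ≠ 0) (hy : ν {y} ≠ 0) (hxy : x * y ≠ y * x) :
    ∑' n, (avg ν)^[n] ({g | (sanovRep g).trace ^ 2 = 4}.indicator (1 : F₂ → ℝ≥0∞)) 1 ≠ ∞ := by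
  have hcomm := sq_mul_ne_mul_sq hxy
  have hcomm' : x ^ 2 * y⁻¹ ≠ y⁻¹ * x ^ 2 := fun h =>
    hcomm (Commute.inv_right_iff.1 (show Commute (x ^ 2) y⁻¹ from h)).eq
  have ht := two_le_trace_sq x
  have hns : ∀ c : ℝ, sanovRep (x ^ 2) ≠ c • 1 := by
    intro c hc
    refine hcomm (injective_sanovRep ?_)
    rw [map_mul, map_mul, hc, smul_one_mul, mul_smul_one]
  obtain ⟨n, s, e, f, e', f', hS, hinj, hs⟩ := exists_schottky det_sanovRep ht hns
    (fun u => wedge_sanovRep_ne_zero hcomm ht) (fun u => wedge_sanovRep_ne_zero hcomm' ht) 48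
  obtain ⟨k, hk⟩ : ∃ k, k = 2 * (48 + n + 1) + 2 := ⟨_, rfl⟩
  have hmem : ∀ i, s i ∈ {g | ν {g} ≠ 0} ^ k := by
    intro i
    have hpow : ∀ m, (x ^ 2) ^ m ∈ {g | ν {g} ≠ 0} ^ (2 * m) := fun m => by
      rw [← pow_mul]
      exact Set.pow_mem_pow hx
    have hki : k = 2 * i + 1 + 2 * (n + 1) + (1 + 2 * (48 - i)) := by omega
    have hy1 : y ∈ {g | ν {g} ≠ 0} ^ 1 := by rwa [pow_one]
    rw [hs, hki]
    simp only [pow_add _ (_ + _), pow_add _ (2 * (i : ℕ)), pow_add _ 1 (2 * _)]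
    exact Set.mul_mem_mul (Set.mul_mem_mul (Set.mul_mem_mul (hpow _) hy1) (hpow _))
      (Set.mul_mem_mul hy1 (hpow _))
  obtain ⟨θ, hθ, hdecay⟩ := exists_decay (convPow ν k) hinj
    (fun i => convPow_singleton_ne_zero ν k (hmem i)) _ (γ := 24) (C := 49) (by norm_num)
    (fun L g => (hS.labelSum_le (β := 12) (by norm_num) (by norm_num) L g).trans (by norm_num))
  exact tsum_iterate_ne_top ν (by omega) _ (by norm_num) hθ hdecay

end Decay

lemma exists_mul_ne_mul_of_closure {G : Type*} [Group G] {s : Set G}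
    (h : ∃ x ∈ Subgroup.closure s, ∃ y ∈ Subgroup.closure s, x * y ≠ y * x) :
    ∃ x ∈ s, ∃ y ∈ s, x * y ≠ y * x := by
  by_contra! hs
  obtain ⟨x, hx, y, hy, hxy⟩ := h
  refine hxy (Subgroup.closure_induction₂ (p := fun x y _ _ => Commute x y)
    (fun x y hx hy => hs x hx y hy) ?_ ?_ ?_ ?_ ?_ ?_ hx hy)
  · simp
  · simp
  · intro _ _ _ _ _ _ h h'; exact h.mul_left h'
  · intro _ _ _ _ _ _ h h'; exact h.mul_right h'
  · intro _ _ _ _ h; exact h.inv_left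
  · intro _ _ _ _ h; exact h.inv_right

end PingPong

/-- Theorem B, free-group form: if `ν` is a probability measure on `F₂`
whose support generates a finitely generated non-abelian subgroup, then almost surely the
random walk driven by `ν` eventually avoids all conjugates of powers of `a`, of `b`, and
of `ab` — i.e. the walk is eventually pseudo-Anosov under Thurston's construction. -/
theorem eventually_pseudo_Anosov
    (ν : Measure F₂) [IsProbabilityMeasure ν]
    (hFG : (Subgroup.closure {g : F₂ | ν {g} ≠ 0}).FG)
    (hNonAb : ∃ x ∈ Subgroup.closure {g : F₂ | ν {g} ≠ 0},
        ∃ y ∈ Subgroup.closure {g : F₂ | ν {g} ≠ 0}, x * y ≠ y * x)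
    (Ω : Type) [MeasureSpace Ω] [IsProbabilityMeasure (ℙ : Measure Ω)]
    (Z : ℕ → Ω → F₂)
    (hindep : iIndepFun (m := fun _ => (inferInstance : MeasurableSpace F₂)) Z ℙ)
    (hlaw : ∀ i, Measure.map (Z i) ℙ = ν) :
    ∀ᵐ x ∂(ℙ : Measure Ω), ∃ N : ℕ, ∀ n > N,
      ¬ ∃ (g : F₂) (k : ℤ),
          g * walk Z n x * g⁻¹ = genA ^ k ∨
          g * walk Z n x * g⁻¹ = genB ^ k ∨
          g * walk Z n x * g⁻¹ = (genA * genB) ^ k := by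
  obtain ⟨x, hx, y, hy, hxy⟩ := PingPong.exists_mul_ne_mul_of_closure hNonAb
  filter_upwards [PingPong.ae_eventually_walk_notMem ν Z hindep hlaw _
    (PingPong.tsum_iterate_avg_ne_top ν hx hy hxy)] with ω hω
  obtain ⟨N, hN⟩ := eventually_atTop.1 hω
  exact ⟨N, fun n hn ⟨g, k, h⟩ => hN n hn.le (PingPong.trace_sanovRep_sq_of_conj h)⟩
end
end

section
/- Probabilistic bound for atypical configurations (Proposition 2.8, probabilistic core). Let n, m ≥ 1 and k ≥ 2 be natural numbers. On a probability space, let {X_{α,β} : α ∈ Fin n, β ∈ Fin m}, {N_α : α ∈ Fin n}, and {M_β : β ∈ Fin m} be jointly independent random variables, where each X_{α,β} is uniformly distributed on {0, 1, …, k−1} and each N_α and each M_β is uniformly distributed on {1, 2, …, k}. Then the probability of the event '(there exists α with N_α · (∑_{β} X_{α,β}) = 1) or (there exists β with M_β · (∑_{α} X_{α,β}) = 1)' is at most 2 − (1 − m/k^{m+1})^n − (1 − n/k^{n+1})^m. -/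
open MeasureTheory ProbabilityTheory

noncomputable section

/-- A function to a countable space is a.e. measurable as soon as the outer measures of its fibers
add up to at most the total mass. -/
lemma aemeasurable_of_tsum_measure_fiber_le {Ω β : Type*} [MeasurableSpace Ω] [MeasurableSpace β]
    [Countable β] [MeasurableSpace.CountablyGenerated β] {μ : Measure Ω} [IsFiniteMeasure μ]
    {f : Ω → β} (h : ∑' b, μ (f ⁻¹' {b}) ≤ μ Set.univ) : AEMeasurable f μ := by
  refine NullMeasurable.aemeasurable fun S _ => ?_
  have hle (T : Set β) : μ (f ⁻¹' T) ≤ ∑' b : T, μ (f ⁻¹' {(b : β)}) := by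
    rw [← Set.biUnion_preimage_singleton, Set.biUnion_eq_iUnion]
    exact measure_iUnion_le _
  have hsum : μ (f ⁻¹' S) + μ (f ⁻¹' Sᶜ) ≤ μ Set.univ :=
    (add_le_add (hle S) (hle Sᶜ)).trans
      ((ENNReal.summable.tsum_add_tsum_compl ENNReal.summable).trans_le h)
  have hmeas : MeasurableSet (toMeasurable μ (f ⁻¹' Sᶜ))ᶜ := (measurableSet_toMeasurable _ _).compl
  refine hmeas.nullMeasurableSet.congr (ae_eq_of_subset_of_measure_ge ?_ ?_
    hmeas.nullMeasurableSet (measure_ne_top _ _))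
  · rw [Set.compl_subset_comm, ← Set.preimage_compl]
    exact subset_toMeasurable _ _
  · rw [measure_compl (measurableSet_toMeasurable _ _) (measure_ne_top _ _), measure_toMeasurable]
    exact ENNReal.le_sub_of_add_le_right (measure_ne_top _ _) hsum

/-- A variable whose law is uniform on a finset of size `k` is a.e. measurable. -/
lemma aemeasurable_of_uniform {Ω : Type*} [MeasurableSpace Ω] {μ : Measure Ω}
    [IsProbabilityMeasure μ] {k : ℕ} {f : Ω → ℕ} (s : Finset ℕ) (hs : s.card = k)
    (hf : ∀ j, μ {x | f x = j} = if j ∈ s then (1 : ENNReal) / k else 0) : AEMeasurable f μ := by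
  refine aemeasurable_of_tsum_measure_fiber_le ?_
  have hfib (j : ℕ) : μ (f ⁻¹' {j}) = if j ∈ s then (1 : ENNReal) / k else 0 := hf j
  simp_rw [hfib]
  rw [tsum_eq_sum (s := s) fun j hj => if_neg hj, Finset.sum_ite_mem, Finset.inter_self,
    Finset.sum_const, hs, nsmul_eq_mul, measure_univ]
  exact ENNReal.mul_div_le

/-- Grouping independent variables indexed by pairs yields independent families. -/
lemma iIndepFun_curry {Ω ι κ E : Type*} [MeasurableSpace Ω] [MeasurableSpace E] [Countable ι]
    [Countable κ] {μ : Measure Ω} {Z : ι × κ → Ω → E} (hZ : ∀ p, AEMeasurable (Z p) μ)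
    (h : iIndepFun Z μ) : iIndepFun (fun i ω j => Z (i, j) ω) μ := by
  have := h.isProbabilityMeasure
  have hprob (p : ι × κ) : IsProbabilityMeasure (μ.map (Z p)) :=
    Measure.isProbabilityMeasure_map (hZ p)
  have hrow (i : ι) : AEMeasurable (fun ω j => Z (i, j) ω) μ :=
    aemeasurable_pi_iff.2 fun j => hZ (i, j)
  have hlaw (i : ι) : μ.map (fun ω j => Z (i, j) ω) =
      Measure.infinitePi fun j => μ.map (Z (i, j)) :=
    (h.precomp (Prod.mk_right_injective i)).map_fun_eq_infinitePi_map₀' fun j => hZ (i, j)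
  rw [iIndepFun_iff_map_fun_eq_infinitePi_map₀' hrow]
  simp_rw [hlaw]
  rw [← Measure.infinitePi_map_curry fun i j => μ.map (Z (i, j)),
    ← h.map_fun_eq_infinitePi_map₀' hZ,
    AEMeasurable.map_map_of_aemeasurable (by fun_prop) (aemeasurable_pi_iff.2 hZ)]
  rfl

/-- A product `a * ∑ j, v j` of naturals equals one only if `a = 1` and `v` is an indicator of a
point. -/
lemma exists_eq_elim_single_of_mul_sum_eq_one {κ : Type*} [Fintype κ] [DecidableEq κ]
    {v : Option κ → ℕ} (h : v none * ∑ j, v (some j) = 1) :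
    ∃ b, ∀ c, v c = c.elim 1 (Pi.single b 1) := by
  obtain ⟨h1, h2⟩ := mul_eq_one.1 h
  obtain ⟨b, -, hb⟩ := Finset.exists_ne_zero_of_sum_ne_zero (h2.trans_ne one_ne_zero)
  rw [← Finset.add_sum_erase _ _ (Finset.mem_univ b)] at h2
  have hb1 : v (some b) = 1 := by omega
  have hz : ∑ j ∈ Finset.univ.erase b, v (some j) = 0 := by omega
  refine ⟨b, fun c => ?_⟩
  rcases c with _ | c
  · exact h1
  · by_cases hc : c = b
    · simp [hc, hb1]
    · simpa [hc] using Finset.sum_eq_zero_iff.1 hz c (by simp [hc])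

/-- The probability that some row product equals one, for independent entries each taking the
relevant values with probability `1 / k`. -/
lemma measureReal_exists_mul_sum_eq_one_le {Ω ι κ : Type*} [MeasurableSpace Ω] [Fintype ι]
    [Fintype κ] {μ : Measure Ω} {k : ℕ} (hk : 2 ≤ k) {Z : ι × Option κ → Ω → ℕ}
    (hZ : ∀ p, AEMeasurable (Z p) μ) (h : iIndepFun Z μ)
    (hone : ∀ p, μ {x | Z p x = 1} = (1 : ENNReal) / k)
    (hzero : ∀ i j, μ {x | Z (i, some j) x = 0} = (1 : ENNReal) / k) :
    μ.real {x | ∃ i, Z (i, none) x * ∑ j, Z (i, some j) x = 1} ≤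
      1 - (1 - (Fintype.card κ : ℝ) / k ^ (Fintype.card κ + 1)) ^ Fintype.card ι := by
  classical
  have := h.isProbabilityMeasure
  have hrow (i : ι) : AEMeasurable (fun ω c => Z (i, c) ω) μ :=
    aemeasurable_pi_iff.2 fun c => hZ (i, c)
  let G : Set (Option κ → ℕ) := {v | v none * ∑ j, v (some j) = 1}
  have hG : MeasurableSet G := measurableSet_eq_fun (by fun_prop) measurable_const
  let E (i : ι) : Set Ω := (fun ω c => Z (i, c) ω) ⁻¹' G
  have hE (i : ι) : NullMeasurableSet (E i) μ := (hrow i).nullMeasurable hG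
  have hEle (i : ι) : μ.real (E i) ≤ (Fintype.card κ : ℝ) / k ^ (Fintype.card κ + 1) := by
    have hsub : E i ⊆ ⋃ b : κ, ⋂ c, Z (i, c) ⁻¹' {c.elim 1 (Pi.single b 1)} := fun x hx => by
      obtain ⟨b, hb⟩ := exists_eq_elim_single_of_mul_sum_eq_one (v := fun c => Z (i, c) x) hx
      exact Set.mem_iUnion.2 ⟨b, Set.mem_iInter.2 hb⟩
    have hatom (b : κ) : μ.real (⋂ c, Z (i, c) ⁻¹' {c.elim 1 (Pi.single b 1)}) =
        1 / k ^ (Fintype.card κ + 1) := by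
      rw [Measure.real, (h.precomp (Prod.mk_right_injective i)).meas_iInter
        fun c => ⟨_, measurableSet_singleton _, rfl⟩]
      have hval (c : Option κ) :
          μ (Z (i, c) ⁻¹' {c.elim 1 (Pi.single b 1)}) = (1 : ENNReal) / k := by
        rcases c with _ | c
        · exact hone _
        · by_cases hc : c = b
          · subst hc
            simpa [Set.preimage] using hone (i, some c)
          · simpa [hc, Set.preimage] using hzero i c
      simp [hval]
    refine (measureReal_mono hsub).trans ((measureReal_iUnion_fintype_le _).trans_eq ?_)
    simp [hatom, div_eq_mul_inv]
  have hq : (Fintype.card κ : ℝ) / k ^ (Fintype.card κ + 1) ≤ 1 := by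
    have hlt : Fintype.card κ < k ^ (Fintype.card κ + 1) :=
      (Nat.lt_pow_self hk).trans_le (Nat.pow_le_pow_right (by omega) (Nat.le_succ _))
    exact div_le_one_of_le₀ (by exact_mod_cast hlt.le) (by positivity)
  have hinter : μ.real (⋂ i, (E i)ᶜ) = ∏ i, (1 - μ.real (E i)) := by
    rw [Measure.real, (iIndepFun_curry hZ h).meas_iInter (s := fun i => (E i)ᶜ)
      fun i => ⟨Gᶜ, hG.compl, rfl⟩, ENNReal.toReal_prod]
    exact Finset.prod_congr rfl fun i _ => probReal_compl_eq_one_sub₀ (hE i)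
  have hunion : {x | ∃ i, Z (i, none) x * ∑ j, Z (i, some j) x = 1} = (⋂ i, (E i)ᶜ)ᶜ := by
    ext x
    simp [E, G]
  rw [hunion, probReal_compl_eq_one_sub₀ (.iInter fun i => (hE i).compl), hinter]
  have hprod : ∏ _i : ι, (1 - (Fintype.card κ : ℝ) / k ^ (Fintype.card κ + 1)) ≤
      ∏ i, (1 - μ.real (E i)) :=
    Finset.prod_le_prod (fun i _ => sub_nonneg.2 hq) fun i _ => sub_le_sub_left (hEle i) 1
  rw [Finset.prod_const, Finset.card_univ] at hprod
  linarith

/-- Proposition 2.8, probabilistic core: with jointly independent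
random variables `X_{α,β}` uniform on `{0,…,k−1}` and `N_α, M_β` uniform on `{1,…,k}`,
the probability that some row product `N_α · ∑_β X_{α,β}` or some column product
`M_β · ∑_α X_{α,β}` equals 1 is at most
`2 − (1 − m/k^{m+1})^n − (1 − n/k^{n+1})^m`. -/
theorem probability_of_degenerate_configuration
    (n m k : ℕ) (hn : 1 ≤ n) (hm : 1 ≤ m) (hk : 2 ≤ k)
    (Ω : Type) [MeasureSpace Ω] [IsProbabilityMeasure (ℙ : Measure Ω)]
    (X : Fin n → Fin m → Ω → ℕ) (N : Fin n → Ω → ℕ) (M : Fin m → Ω → ℕ)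
    (hindep : iIndepFun (m := fun _ => (inferInstance : MeasurableSpace ℕ))
      (Sum.elim (fun p : Fin n × Fin m => X p.1 p.2) (Sum.elim N M)) ℙ)
    (hXunif : ∀ α β, ∀ j : ℕ,
      ℙ {x : Ω | X α β x = j} = if j < k then (1 : ENNReal) / k else 0)
    (hNunif : ∀ α, ∀ j : ℕ,
      ℙ {x : Ω | N α x = j} = if 1 ≤ j ∧ j ≤ k then (1 : ENNReal) / k else 0)
    (hMunif : ∀ β, ∀ j : ℕ,
      ℙ {x : Ω | M β x = j} = if 1 ≤ j ∧ j ≤ k then (1 : ENNReal) / k else 0) :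
    ℙ {x : Ω | (∃ α, N α x * (∑ β, X α β x) = 1) ∨ (∃ β, M β x * (∑ α, X α β x) = 1)} ≤
      ENNReal.ofReal (2 - (1 - (m : ℝ) / k ^ (m + 1)) ^ n
        - (1 - (n : ℝ) / k ^ (n + 1)) ^ m) := by
  have hXm (α β) : AEMeasurable (X α β) ℙ :=
    aemeasurable_of_uniform (k := k) (Finset.range k) (by simp) (by simpa using hXunif α β)
  have hNm (α) : AEMeasurable (N α) ℙ :=
    aemeasurable_of_uniform (k := k) (Finset.Icc 1 k) (by simp) (by simpa using hNunif α)
  have hMm (β) : AEMeasurable (M β) ℙ :=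
    aemeasurable_of_uniform (k := k) (Finset.Icc 1 k) (by simp) (by simpa using hMunif β)
  have hX1 (α β) : ℙ {x | X α β x = 1} = (1 : ENNReal) / k := by
    rw [hXunif, if_pos (by omega)]
  have hX0 (α β) : ℙ {x | X α β x = 0} = (1 : ENNReal) / k := by
    rw [hXunif, if_pos (by omega)]
  have hN1 (α) : ℙ {x | N α x = 1} = (1 : ENNReal) / k := by
    rw [hNunif, if_pos (by omega)]
  have hM1 (β) : ℙ {x | M β x = 1} = (1 : ENNReal) / k := by
    rw [hMunif, if_pos (by omega)]
  have hrows : (ℙ : Measure Ω).real {x | ∃ α, N α x * (∑ β, X α β x) = 1} ≤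
      1 - (1 - (m : ℝ) / k ^ (m + 1)) ^ n := by
    let g : Fin n × Option (Fin m) → (Fin n × Fin m) ⊕ (Fin n ⊕ Fin m) := fun p =>
      p.2.elim (.inr (.inl p.1)) fun β => .inl (p.1, β)
    have hg : g.Injective := by
      rintro ⟨α, _ | β⟩ ⟨α', _ | β'⟩ hgg <;> simp_all [g]
    simpa [g] using measureReal_exists_mul_sum_eq_one_le hk
      (by rintro ⟨α, _ | β⟩; exacts [hNm α, hXm α β]) (hindep.precomp hg)
      (by rintro ⟨α, _ | β⟩; exacts [hN1 α, hX1 α β]) hX0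
  have hcols : (ℙ : Measure Ω).real {x | ∃ β, M β x * (∑ α, X α β x) = 1} ≤
      1 - (1 - (n : ℝ) / k ^ (n + 1)) ^ m := by
    let g : Fin m × Option (Fin n) → (Fin n × Fin m) ⊕ (Fin n ⊕ Fin m) := fun p =>
      p.2.elim (.inr (.inr p.1)) fun α => .inl (α, p.1)
    have hg : g.Injective := by
      rintro ⟨β, _ | α⟩ ⟨β', _ | α'⟩ hgg <;> simp_all [g]
    simpa [g] using measureReal_exists_mul_sum_eq_one_le hk
      (by rintro ⟨β, _ | α⟩; exacts [hMm β, hXm α β]) (hindep.precomp hg)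
      (by rintro ⟨β, _ | α⟩; exacts [hM1 β, hX1 α β]) fun β α => hX0 α β
  rw [Set.ofPred_or, ← ofReal_measureReal]
  refine ENNReal.ofReal_le_ofReal ((measureReal_union_le _ _).trans ?_)
  linarith
end
end
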